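/- Let n ≥ 1, let p⃗, s⃗ be n-tuples with 1 < pᵢ, sᵢ ≤ ∞ and let 1 ≤ α ≤ ∞ satisfy (1/n)Σᵢ 1/sᵢ ≤ 1/α ≤ (1/n)Σᵢ 1/pᵢ, with conjugate exponents p⃗′, s⃗′, α′. The map T sending g ∈ (L^{p⃗},ℓ^{s⃗})^α(ℝⁿ) to the functional T_g(f) = ∫_{ℝⁿ} f(x)g(x) dx on H(p⃗′,s⃗′,α′) is a linear isometric isomorphism of (L^{p⃗},ℓ^{s⃗})^α(ℝⁿ) onto the dual space H(p⃗′,s⃗′,α′)*: T is injective, every bounded linear functional on H(p⃗′,s⃗′,α′) equals T_g for some g ∈ (L^{p⃗},ℓ^{s⃗})^α(ℝⁿ), and ‖T_g‖ = ‖g‖_{p⃗,s⃗,α}. -/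

import Mathlib

open MeasureTheory ENNReal Filter Topology Set

noncomputable section

namespace MixedAmalgam

/-- `L^p` norm over `ℝ` of an `ℝ≥0∞`-valued function, with the usual
modification (`essSup`) for `p = ∞`. -/
def lpInt (p : ℝ≥0∞) (g : ℝ → ℝ≥0∞) : ℝ≥0∞ :=
  if p = ∞ then essSup g volume else (∫⁻ t, g t ^ p.toReal) ^ (1 / p.toReal)

/-- `ℓ^p` norm over `ℤ` of an `ℝ≥0∞`-valued family, with the usual
modification for `p = ∞`. -/
def lpSum (p : ℝ≥0∞) (g : ℤ → ℝ≥0∞) : ℝ≥0∞ :=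
  if p = ∞ then ⨆ k, g k else (∑' k, g k ^ p.toReal) ^ (1 / p.toReal)

/-- Iterated mixed Lebesgue norm of an `ℝ≥0∞`-valued function on `ℝⁿ`,
taking the `L^{p₁}` norm in the first variable innermost, and the `L^{pₙ}`
norm in the last variable outermost. -/
def mixedE : (n : ℕ) → (Fin n → ℝ≥0∞) → ((Fin n → ℝ) → ℝ≥0∞) → ℝ≥0∞
  | 0, _, g => g Fin.elim0
  | n + 1, p, g =>
    lpInt (p (Fin.last n)) fun t =>
      mixedE n (fun i => p i.castSucc) fun x => g (Fin.snoc x t)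

/-- Mixed-norm Lebesgue norm `‖f‖_{L^{p⃗}}` of a real-valued function on `ℝⁿ`. -/
def mixedLp (n : ℕ) (p : Fin n → ℝ≥0∞) (f : (Fin n → ℝ) → ℝ) : ℝ≥0∞ :=
  mixedE n p fun x => (‖f x‖₊ : ℝ≥0∞)

/-- Iterated mixed `ℓ^{s⃗}` norm of an `ℝ≥0∞`-valued family indexed by `ℤⁿ`. -/
def mixedSeq : (n : ℕ) → (Fin n → ℝ≥0∞) → ((Fin n → ℤ) → ℝ≥0∞) → ℝ≥0∞
  | 0, _, a => a Fin.elim0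
  | n + 1, s, a =>
    lpSum (s (Fin.last n)) fun k =>
      mixedSeq n (fun i => s i.castSucc) fun m => a (Fin.snoc m k)

/-- Open Euclidean ball of center `y` and radius `r` in `ℝⁿ`. -/
def eball (n : ℕ) (y : Fin n → ℝ) (r : ℝ) : Set (Fin n → ℝ) :=
  {x | Real.sqrt (∑ i, (x i - y i) ^ 2) < r}

/-- `Σᵢ 1/pᵢ` as a real number. -/
def invSum (n : ℕ) (p : Fin n → ℝ≥0∞) : ℝ :=
  ∑ i, (1 / p i).toReal

/-- The `(L^{p⃗},L^{s⃗})` amalgam norm computed with balls of radius `r`. -/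
def amalgamNormR (n : ℕ) (p s : Fin n → ℝ≥0∞) (r : ℝ) (f : (Fin n → ℝ) → ℝ) : ℝ≥0∞ :=
  mixedE n s fun y => mixedLp n p ((eball n y r).indicator f)

/-- The amalgam norm `‖f‖_{(L^{p⃗},L^{s⃗})}`. -/
def amalgamNorm (n : ℕ) (p s : Fin n → ℝ≥0∞) (f : (Fin n → ℝ) → ℝ) : ℝ≥0∞ :=
  amalgamNormR n p s 1 f

/-- The amalgam norm `‖f‖_{(L^{p⃗},L^{s⃗})^α}`. -/
def amalgamNormA (n : ℕ) (p s : Fin n → ℝ≥0∞) (α : ℝ≥0∞) (f : (Fin n → ℝ) → ℝ) : ℝ≥0∞ :=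
  ⨆ (r : ℝ) (_ : 0 < r),
    mixedE n s fun y =>
      volume (eball n y r) ^
          ((1 / α).toReal - invSum n p / (n : ℝ) - invSum n s / (n : ℝ)) *
        mixedLp n p ((eball n y r).indicator f)

/-- The amalgam norm `‖·‖_{(L^{p⃗},L^{s⃗})^α}` for `ℝ≥0∞`-valued functions. -/
def amalgamNormAE (n : ℕ) (p s : Fin n → ℝ≥0∞) (α : ℝ≥0∞)
    (g : (Fin n → ℝ) → ℝ≥0∞) : ℝ≥0∞ :=
  ⨆ (r : ℝ) (_ : 0 < r),
    mixedE n s fun y =>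
      volume (eball n y r) ^
          ((1 / α).toReal - invSum n p / (n : ℝ) - invSum n s / (n : ℝ)) *
        mixedE n p ((eball n y r).indicator g)

/-- The cube `Q_{r,k} = r(k + [0,1)ⁿ)`. -/
def qcube (n : ℕ) (r : ℝ) (k : Fin n → ℤ) : Set (Fin n → ℝ) :=
  {x | ∀ i, r * (k i : ℝ) ≤ x i ∧ x i < r * ((k i : ℝ) + 1)}

/-- The discrete amalgam norm `_r‖f‖_{p⃗,s⃗}`. -/
def discNormR (n : ℕ) (p s : Fin n → ℝ≥0∞) (r : ℝ) (f : (Fin n → ℝ) → ℝ) : ℝ≥0∞ :=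
  mixedSeq n s fun k => mixedLp n p ((qcube n r k).indicator f)

/-- The discrete amalgam norm `‖f‖_{p⃗,s⃗} = _1‖f‖_{p⃗,s⃗}`. -/
def discNorm (n : ℕ) (p s : Fin n → ℝ≥0∞) (f : (Fin n → ℝ) → ℝ) : ℝ≥0∞ :=
  discNormR n p s 1 f

/-- The discrete amalgam norm
`‖f‖_{p⃗,s⃗,α} = sup_{r>0} r^{n/α - Σᵢ 1/pᵢ} · _r‖f‖_{p⃗,s⃗}`. -/
def discNormA (n : ℕ) (p s : Fin n → ℝ≥0∞) (α : ℝ≥0∞) (f : (Fin n → ℝ) → ℝ) : ℝ≥0∞ :=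
  ⨆ (r : ℝ) (_ : 0 < r),
    ENNReal.ofReal (r ^ ((n : ℝ) * (1 / α).toReal - invSum n p)) * discNormR n p s r f

/-- Membership in `(L^{p⃗},L^{s⃗})^α(ℝⁿ)` (continuous form). -/
def memA (n : ℕ) (p s : Fin n → ℝ≥0∞) (α : ℝ≥0∞) (f : (Fin n → ℝ) → ℝ) : Prop :=
  LocallyIntegrable f volume ∧ amalgamNormA n p s α f < ∞

/-- Membership in `(L^{p⃗},ℓ^{s⃗})(ℝⁿ)`. -/
def memD (n : ℕ) (p s : Fin n → ℝ≥0∞) (f : (Fin n → ℝ) → ℝ) : Prop :=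
  LocallyIntegrable f volume ∧ discNorm n p s f < ∞

/-- Membership in `(L^{p⃗},ℓ^{s⃗})^α(ℝⁿ)`. -/
def memDA (n : ℕ) (p s : Fin n → ℝ≥0∞) (α : ℝ≥0∞) (f : (Fin n → ℝ) → ℝ) : Prop :=
  LocallyIntegrable f volume ∧ discNormA n p s α f < ∞

/-- The dilation `St_r^{(α)} f = r^{-n/α} f(r⁻¹ ·)`. -/
def dil (n : ℕ) (α : ℝ≥0∞) (r : ℝ) (f : (Fin n → ℝ) → ℝ) : (Fin n → ℝ) → ℝ :=
  fun x => r ^ (-((n : ℝ) * (1 / α).toReal)) * f (r⁻¹ • x)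

/-- A block decomposition `f = Σ_j c_j St_{r_j}^{(α')} f_j` converging in `L¹_loc`. -/
structure BlockDecomp (n : ℕ) (p' s' : Fin n → ℝ≥0∞) (α' : ℝ≥0∞) (f : (Fin n → ℝ) → ℝ)
    (c : ℕ → ℝ) (rr : ℕ → ℝ) (g : ℕ → (Fin n → ℝ) → ℝ) : Prop where
  csummable : Summable fun j => |c j|
  rpos : ∀ j, 0 < rr j
  gloc : ∀ j, LocallyIntegrable (g j) volume
  gnorm : ∀ j, discNorm n p' s' (g j) ≤ 1
  conv : ∀ K : Set (Fin n → ℝ), IsCompact K →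
    Tendsto (fun J : ℕ =>
        ∫⁻ x in K,
          (‖f x - ∑ j ∈ Finset.range J, c j * dil n α' (rr j) (g j) x‖₊ : ℝ≥0∞))
      atTop (𝓝 0)

/-- Membership in the block space `H(p⃗',s⃗',α')`. -/
def memH (n : ℕ) (p' s' : Fin n → ℝ≥0∞) (α' : ℝ≥0∞) (f : (Fin n → ℝ) → ℝ) : Prop :=
  LocallyIntegrable f volume ∧ ∃ c rr g, BlockDecomp n p' s' α' f c rr g

/-- The norm of the block space `H(p⃗',s⃗',α')`. -/
def hNorm (n : ℕ) (p' s' : Fin n → ℝ≥0∞) (α' : ℝ≥0∞) (f : (Fin n → ℝ) → ℝ) : ℝ≥0∞ :=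
  ⨅ (c : ℕ → ℝ) (rr : ℕ → ℝ) (g : ℕ → (Fin n → ℝ) → ℝ)
    (_ : BlockDecomp n p' s' α' f c rr g), ENNReal.ofReal (∑' j, |c j|)

/-- The fractional integral operator `I_γ`. -/
def fracInt (n : ℕ) (γ : ℝ) (f : (Fin n → ℝ) → ℝ) : (Fin n → ℝ) → ℝ :=
  fun x => ∫ y, f y / Real.sqrt (∑ i, (x i - y i) ^ 2) ^ ((n : ℝ) - γ)

/-- The fractional maximal operator `M_γ`. -/
def fracMax (n : ℕ) (γ : ℝ) (f : (Fin n → ℝ) → ℝ) : (Fin n → ℝ) → ℝ≥0∞ :=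
  fun x => ⨆ (y : Fin n → ℝ) (r : ℝ) (_ : 0 < r) (_ : x ∈ eball n y r),
    volume (eball n y r) ^ (γ / (n : ℝ) - 1) * ∫⁻ z in eball n y r, (‖f z‖₊ : ℝ≥0∞)

/-- The commutator `[b, I_γ] f`. -/
def commFracInt (n : ℕ) (γ : ℝ) (b f : (Fin n → ℝ) → ℝ) : (Fin n → ℝ) → ℝ :=
  fun x => ∫ y, (b x - b y) * f y / Real.sqrt (∑ i, (x i - y i) ^ 2) ^ ((n : ℝ) - γ)

/-- The mean value `b_B` of `b` over the ball `B(y,r)`. -/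
def ballAvg (n : ℕ) (b : (Fin n → ℝ) → ℝ) (y : Fin n → ℝ) (r : ℝ) : ℝ :=
  (volume (eball n y r)).toReal⁻¹ * ∫ x in eball n y r, b x

/-- The `BMO` norm `sup_B (1/|B|) ∫_B |b - b_B|`. -/
def bmoNorm (n : ℕ) (b : (Fin n → ℝ) → ℝ) : ℝ≥0∞ :=
  ⨆ (y : Fin n → ℝ) (r : ℝ) (_ : 0 < r),
    ENNReal.ofReal
      ((volume (eball n y r)).toReal⁻¹ * ∫ x in eball n y r, |b x - ballAvg n b y r|)

structure Good {X : Type} [MeasurableSpace X] (μ : Measure X)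
    (N N' : (X → ℝ≥0∞) → ℝ≥0∞) : Prop where
  meas : ∀ (T : Type) [MeasurableSpace T] (F : T → X → ℝ≥0∞),
    Measurable (Function.uncurry F) → Measurable fun t => N (F t)
  meas' : ∀ (T : Type) [MeasurableSpace T] (F : T → X → ℝ≥0∞),
    Measurable (Function.uncurry F) → Measurable fun t => N' (F t)
  mono' : ∀ f g : X → ℝ≥0∞, f ≤ g → N' f ≤ N' g
  ae : ∀ f g : X → ℝ≥0∞, f =ᵐ[μ] g → N f = N g
  ae' : ∀ f g : X → ℝ≥0∞, f =ᵐ[μ] g → N' f = N' g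
  holder : ∀ f g : X → ℝ≥0∞, Measurable f → Measurable g →
    ∫⁻ x, f x * g x ∂μ ≤ N f * N' g
  conv : ∀ (T : Type) [MeasurableSpace T] (F : T → X → ℝ≥0∞),
    Measurable (Function.uncurry F) →
    ∃ f : ℕ → T → X → ℝ≥0∞, (∀ j, Measurable (Function.uncurry (f j))) ∧
      (∀ j t, N' (f j t) ≤ 1) ∧ ∀ t, N (F t) ≤ ⨆ j, ∫⁻ x, f j t x * F t x ∂μ
  fin' : ∀ f : X → ℝ≥0∞, Measurable f → N' f < ∞ → ∀ᵐ x ∂μ, f x < ∞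
  dct' : ∀ (f : ℕ → X → ℝ≥0∞) (F : X → ℝ≥0∞), (∀ j, Measurable (f j)) → Measurable F →
    (∀ j, ∀ᵐ x ∂μ, f j x ≤ F x) → N' F < ∞ → (∀ᵐ x ∂μ, Tendsto (fun j => f j x) atTop (𝓝 0)) →
    Tendsto (fun j => N' (f j)) atTop (𝓝 0)
  homog' : ∀ (c : ℝ≥0∞) (f : X → ℝ≥0∞), Measurable f → N' (fun x => c * f x) ≤ c * N' f

/-- from a sequence to a monotone one -/
theorem Good.conv_mono {X : Type} [MeasurableSpace X] {μ : Measure X} [SFinite μ]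
    {N N' : (X → ℝ≥0∞) → ℝ≥0∞} (h : Good μ N N') (T : Type) [MeasurableSpace T]
    (F : T → X → ℝ≥0∞) (hF : Measurable (Function.uncurry F)) :
    ∃ f : ℕ → T → X → ℝ≥0∞, (∀ j, Measurable (Function.uncurry (f j))) ∧
      (∀ j t, N' (f j t) ≤ 1) ∧ (∀ t, Monotone fun j => ∫⁻ x, f j t x * F t x ∂μ) ∧
      ∀ t, N (F t) ≤ ⨆ j, ∫⁻ x, f j t x * F t x ∂μ := by
  classical
  obtain ⟨f, hf, hf1, hf2⟩ := h.conv T F hF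
  let g : ℕ → T → X → ℝ≥0∞ := fun j => Nat.rec (f 0) (fun j gj t =>
    if ∫⁻ x, f (j+1) t x * F t x ∂μ ≤ ∫⁻ x, gj t x * F t x ∂μ then gj t else f (j+1) t) j
  have gs : ∀ j t, g (j+1) t = if ∫⁻ x, f (j+1) t x * F t x ∂μ ≤ ∫⁻ x, g j t x * F t x ∂μ
      then g j t else f (j+1) t := fun j t => rfl
  have hint : ∀ u : T → X → ℝ≥0∞, Measurable (Function.uncurry u) →
      Measurable fun t => ∫⁻ x, u t x * F t x ∂μ := by
    intro u hu
    exact Measurable.lintegral_prod_right (f := fun t x => u t x * F t x) (Measurable.mul hu hF)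
  have gm : ∀ j, Measurable (Function.uncurry (g j)) := by
    intro j
    induction j with
    | zero => exact hf 0
    | succ j ih =>
      have : Function.uncurry (g (j+1)) = fun z : T × X =>
        if z ∈ {z : T × X | ∫⁻ x, f (j+1) z.1 x * F z.1 x ∂μ ≤ ∫⁻ x, g j z.1 x * F z.1 x ∂μ}
          then Function.uncurry (g j) z else Function.uncurry (f (j+1)) z := by
        funext z
        simp only [Function.uncurry, gs, mem_ofPred_eq]
        split_ifs <;> rfl
      rw [this]
      refine Measurable.ite ?_ ih (hf _)
      exact measurableSet_le ((hint _ (hf (j+1))).comp measurable_fst)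
        ((hint _ ih).comp measurable_fst)
  refine ⟨g, gm, ?_, ?_, ?_⟩
  · intro j t
    induction j with
    | zero => exact hf1 0 t
    | succ j ih =>
      rw [gs]; split_ifs
      · exact ih
      · exact hf1 _ _
  · intro t
    refine monotone_nat_of_le_succ fun j => ?_
    rw [gs]
    split_ifs with hh
    · exact le_rfl
    · exact (not_le.1 hh).le
  · intro t
    refine (hf2 t).trans (iSup_mono fun j => ?_)
    cases j with
    | zero => exact le_rfl
    | succ j =>
      rw [gs]
      split_ifs with hh
      · exact hh
      · exact le_rfl

theorem Good.prod {X Y : Type} [MeasurableSpace X] [MeasurableSpace Y] {μ : Measure X}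
    {ν : Measure Y} [SFinite μ] [SFinite ν] {N N' : (X → ℝ≥0∞) → ℝ≥0∞}
    {M M' : (Y → ℝ≥0∞) → ℝ≥0∞} (hN : Good μ N N') (hM : Good ν M M') :
    Good (ν.prod μ) (fun F => M fun y => N fun x => F (y, x))
      (fun F => M' fun y => N' fun x => F (y, x)) where
  meas T _ F hF := by
    refine hM.meas T (fun t y => N fun x => F t (y, x)) ?_
    refine hN.meas (T × Y) (fun z x => F z.1 (z.2, x)) ?_
    exact hF.comp (by fun_prop : Measurable fun z : (T × Y) × X => (z.1.1, (z.1.2, z.2)))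
  meas' T _ F hF := by
    refine hM.meas' T (fun t y => N' fun x => F t (y, x)) ?_
    refine hN.meas' (T × Y) (fun z x => F z.1 (z.2, x)) ?_
    exact hF.comp (by fun_prop : Measurable fun z : (T × Y) × X => (z.1.1, (z.1.2, z.2)))
  mono' f g h := hM.mono' _ _ fun y => hN.mono' _ _ fun x => h _
  ae f g h := by
    refine hM.ae _ _ ?_
    filter_upwards [Measure.ae_ae_of_ae_prod h] with y hy using hN.ae _ _ hy
  ae' f g h := by
    refine hM.ae' _ _ ?_
    filter_upwards [Measure.ae_ae_of_ae_prod h] with y hy using hN.ae' _ _ hy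
  holder f g hf hg := by
    rw [lintegral_prod (fun z => f z * g z) (hf.mul hg).aemeasurable]
    refine le_trans (lintegral_mono fun y => hN.holder (fun x => f (y, x)) (fun x => g (y, x))
      (by fun_prop) (by fun_prop)) ?_
    exact hM.holder (fun y => N fun x => f (y, x)) (fun y => N' fun x => g (y, x))
      (hN.meas Y (fun y x => f (y, x)) hf) (hN.meas' Y (fun y x => g (y, x)) hg)
  conv T _ F hF := by
    have hF2 : Measurable fun z : (T × Y) × X => F z.1.1 (z.1.2, z.2) :=
      hF.comp (by fun_prop : Measurable fun z : (T × Y) × X => (z.1.1, (z.1.2, z.2)))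
    obtain ⟨f, fm, f1, fmono, fs⟩ := hN.conv_mono (T × Y) (fun z x => F z.1 (z.2, x)) hF2
    have hφ : Measurable (Function.uncurry fun (t : T) (y : Y) => N fun x => F t (y, x)) :=
      hN.meas (T × Y) (fun z x => F z.1 (z.2, x)) hF2
    obtain ⟨h, hm, h1, hs⟩ := hM.conv T _ hφ
    refine ⟨fun j t z => h j.unpair.1 t z.1 * f j.unpair.2 (t, z.1) z.2, ?_, ?_, ?_⟩
    · intro j
      refine Measurable.mul ?_ ?_
      · exact (hm j.unpair.1).comp (by fun_prop : Measurable fun z : T × Y × X => (z.1, z.2.1))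
      · exact (fm j.unpair.2).comp
          (by fun_prop : Measurable fun z : T × Y × X => ((z.1, z.2.1), z.2.2))
    · intro j t
      refine le_trans (hM.mono' _ _ fun y => ?_) (h1 j.unpair.1 t)
      refine (hN.homog' (h j.unpair.1 t y) (fun x => f j.unpair.2 (t, y) x) ?_).trans ?_
      · exact (fm _).comp (by fun_prop : Measurable fun x : X => ((t, y), x))
      · exact mul_le_of_le_one_right' (f1 _ _)
    · intro t
      refine (hs t).trans (iSup_le fun m => ?_)
      have e1 : ∀ y, (N fun x => F t (y, x)) ≤ ⨆ k, ∫⁻ x, f k (t, y) x * F t (y, x) ∂μ :=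
        fun y => fs (t, y)
      have mk : ∀ k, Measurable fun y => ∫⁻ x, f k (t, y) x * F t (y, x) ∂μ := by
        intro k
        refine Measurable.lintegral_prod_right
          (f := fun y x => f k (t, y) x * F t (y, x)) ?_
        refine Measurable.mul ?_ ?_
        · exact (fm k).comp (by fun_prop : Measurable fun z : Y × X => ((t, z.1), z.2))
        · exact hF.comp (by fun_prop : Measurable fun z : Y × X => (t, (z.1, z.2)))
      have hmm : Measurable (h m t) := (hm m).comp (by fun_prop : Measurable fun y : Y => (t, y))
      calc _ ≤ ∫⁻ y, ⨆ k, h m t y * ∫⁻ x, f k (t, y) x * F t (y, x) ∂μ ∂ν := by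
            refine lintegral_mono fun y => ?_
            dsimp only
            rw [← ENNReal.mul_iSup]
            gcongr
            exact e1 y
        _ = ⨆ k, ∫⁻ y, h m t y * ∫⁻ x, f k (t, y) x * F t (y, x) ∂μ ∂ν := by
            refine lintegral_iSup (fun k => hmm.mul (mk k)) ?_
            intro a b hab y
            dsimp only
            exact mul_le_mul_right (fmono (t, y) hab) _
        _ ≤ _ := by
            refine iSup_le fun k => ?_
            refine le_trans (le_of_eq ?_) (le_iSup _ (Nat.pair m k))
            rw [lintegral_prod]
            · refine lintegral_congr fun y => ?_
              simp only [Nat.unpair_pair]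
              rw [← lintegral_const_mul]
              · refine lintegral_congr fun x => ?_
                ring
              · refine Measurable.mul ?_ ?_
                · exact (fm k).comp (by fun_prop : Measurable fun x : X => ((t, y), x))
                · exact hF.comp (by fun_prop : Measurable fun x : X => (t, (y, x)))
            · refine Measurable.aemeasurable ?_
              refine Measurable.mul (Measurable.mul ?_ ?_) ?_
              · exact (hm _).comp (by fun_prop : Measurable fun z : Y × X => (t, z.1))
              · exact (fm _).comp (by fun_prop : Measurable fun z : Y × X => ((t, z.1), z.2))
              · exact hF.comp (by fun_prop : Measurable fun z : Y × X => (t, z))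
  fin' f hf h := by
    refine (Measure.ae_prod_iff_ae_ae (hf measurableSet_Iio)).2 ?_
    filter_upwards [hM.fin' _ (hN.meas' Y (fun y x => f (y, x)) hf) h] with y hy
    exact hN.fin' (fun x => f (y, x)) (by fun_prop) hy
  dct' f F hf hF hle hfin hlim := by
    refine hM.dct' (fun j y => N' fun x => f j (y, x)) (fun y => N' fun x => F (y, x))
      (fun j => hN.meas' Y (fun y x => f j (y, x)) (hf j))
      (hN.meas' Y (fun y x => F (y, x)) hF) ?_ hfin ?_
    · intro j
      filter_upwards [Measure.ae_ae_of_ae_prod (hle j)] with y hy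
      calc N' (fun x => f j (y, x)) = N' (fun x => min (f j (y, x)) (F (y, x))) := by
            refine hN.ae' _ _ ?_
            filter_upwards [hy] with x hx
            rw [min_eq_left hx]
        _ ≤ _ := hN.mono' _ _ fun x => min_le_right _ _
    · filter_upwards [hM.fin' _ (hN.meas' Y (fun y x => F (y, x)) hF) hfin,
        Measure.ae_ae_of_ae_prod hlim,
        ae_all_iff.2 fun j => Measure.ae_ae_of_ae_prod (hle j)] with y h1 h2 h3
      exact hN.dct' (fun j x => f j (y, x)) (fun x => F (y, x))
        (fun j => (hf j).comp (by fun_prop)) (by fun_prop) h3 h1 h2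
  homog' c f hf := by
    refine le_trans (hM.mono' _ _ fun y => hN.homog' c (fun x => f (y, x)) (by fun_prop)) ?_
    exact hM.homog' c _ (hN.meas' Y (fun y x => f (y, x)) hf)

theorem Good.transport {X Y : Type} [MeasurableSpace X] [MeasurableSpace Y] {μ : Measure X}
    {ν : Measure Y} {N N' : (Y → ℝ≥0∞) → ℝ≥0∞} (hN : Good ν N N')
    (e : X ≃ᵐ Y) (he : MeasurePreserving e μ ν) :
    Good μ (fun F => N fun y => F (e.symm y)) (fun F => N' fun y => F (e.symm y)) := by
  have he' : MeasurePreserving e.symm ν μ := he.symm e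
  refine ⟨?_, ?_, ?_, ?_, ?_, ?_, ?_, ?_, ?_, ?_⟩
  · intro T _ F hF
    refine hN.meas T (fun t y => F t (e.symm y)) ?_
    exact hF.comp (measurable_fst.prodMk (e.symm.measurable.comp measurable_snd))
  · intro T _ F hF
    refine hN.meas' T (fun t y => F t (e.symm y)) ?_
    exact hF.comp (measurable_fst.prodMk (e.symm.measurable.comp measurable_snd))
  · intro f g h
    exact hN.mono' _ _ fun y => h _
  · intro f g h
    exact hN.ae _ _ (he'.quasiMeasurePreserving.ae h)
  · intro f g h
    exact hN.ae' _ _ (he'.quasiMeasurePreserving.ae h)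
  · intro f g hf hg
    rw [← he'.lintegral_comp (f := fun x => f x * g x) (hf.mul hg)]
    exact hN.holder _ _ (hf.comp e.symm.measurable) (hg.comp e.symm.measurable)
  · intro T _ F hF
    obtain ⟨f, fm, f1, fs⟩ := hN.conv T (fun t y => F t (e.symm y))
      (hF.comp (measurable_fst.prodMk (e.symm.measurable.comp measurable_snd)))
    have fm' : ∀ j, Measurable (Function.uncurry fun t x => f j t (e x)) := fun j =>
      (fm j).comp (measurable_fst.prodMk (e.measurable.comp measurable_snd))
    refine ⟨fun j t x => f j t (e x), fm', ?_, ?_⟩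
    · intro j t
      simpa using f1 j t
    · intro t
      refine (fs t).trans (iSup_mono fun j => ?_)
      rw [← he'.lintegral_comp]
      · simp
      · exact ((fm' j).comp (measurable_const.prodMk measurable_id)).mul
          (hF.comp (measurable_const.prodMk measurable_id))
  · intro f hf h
    have := he.quasiMeasurePreserving.ae (hN.fin' _ (hf.comp e.symm.measurable) h)
    simpa using this
  · intro f F hf hF hle hfin hlim
    exact hN.dct' (fun j y => f j (e.symm y)) _ (fun j => (hf j).comp e.symm.measurable)
      (hF.comp e.symm.measurable)
      (fun j => he'.quasiMeasurePreserving.ae (hle j)) hfin (he'.quasiMeasurePreserving.ae hlim)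
  · intro c f hf
    exact hN.homog' c _ (hf.comp e.symm.measurable)

/-- general one-dimensional norm -/
def lpN {Y : Type} [MeasurableSpace Y] (ν : Measure Y) (p : ℝ≥0∞) (g : Y → ℝ≥0∞) : ℝ≥0∞ :=
  if p = ∞ then essSup g ν else (∫⁻ t, g t ^ p.toReal ∂ν) ^ (1 / p.toReal)

theorem conj_facts {p p' : ℝ≥0∞} (hp : 1 < p) (h : 1 / p + 1 / p' = 1) :
    p' ≠ ∞ ∧ 1 ≤ p'.toReal ∧ (p = ∞ → p' = 1) ∧
      (p ≠ ∞ → p.toReal.HolderConjugate p'.toReal) := by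
  have hc : ENNReal.HolderConjugate p p' := by
    rw [ENNReal.holderConjugate_iff]; simpa using h
  have h1 : p' ≠ ∞ := by
    rintro rfl
    simp at h
    exact absurd h hp.ne'
  have h2 : 1 ≤ p' := by
    have : 1 / p' ≤ 1 := le_of_le_of_eq (le_add_self (a := 1 / p') (b := 1 / p)) h
    simpa using this
  refine ⟨h1, ?_, ?_, ?_⟩
  · have := ENNReal.toReal_mono h1 h2
    simpa using this
  · rintro rfl
    simpa using h
  · intro hpt
    refine Real.holderConjugate_iff.2 ⟨?_, ?_⟩
    · have := (ENNReal.toReal_lt_toReal one_ne_top hpt).2 hp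
      simpa using this
    · have := congrArg ENNReal.toReal h
      rw [ENNReal.toReal_add] at this
      · simpa using this
      · simpa using (zero_lt_one.trans hp).ne'
      · simpa using (zero_lt_one.trans_le h2).ne'

theorem lpN_top {Y : Type} [MeasurableSpace Y] (ν : Measure Y) (g : Y → ℝ≥0∞) :
    lpN ν ∞ g = essSup g ν := by simp [lpN]

theorem lpN_fin {Y : Type} [MeasurableSpace Y] (ν : Measure Y) {p : ℝ≥0∞} (hp : p ≠ ∞)
    (g : Y → ℝ≥0∞) : lpN ν p g = (∫⁻ t, g t ^ p.toReal ∂ν) ^ (1 / p.toReal) := by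
  simp [lpN, hp]

theorem measurable_essSup_param {T Y : Type} [MeasurableSpace T] [MeasurableSpace Y]
    (ν : Measure Y) [SFinite ν] (F : T → Y → ℝ≥0∞) (hF : Measurable (Function.uncurry F)) :
    Measurable fun t => essSup (F t) ν := by
  refine measurable_of_Iic fun c => ?_
  have : (fun t => essSup (F t) ν) ⁻¹' Iic c =
      (fun t => ν (Prod.mk t ⁻¹' (Function.uncurry F ⁻¹' Ioi c))) ⁻¹' {0} := by
    ext t
    simp only [mem_preimage, mem_Iic, mem_singleton_iff]
    constructor
    · intro h
      have h2 : ∀ᵐ y ∂ν, F t y ≤ c := (ENNReal.ae_le_essSup (F t)).mono fun y hy => hy.trans h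
      rw [ae_iff] at h2
      convert h2 using 3
      ext y
      simp [Function.uncurry]
    · intro h
      refine essSup_le_of_ae_le _ ?_
      rw [EventuallyLE, ae_iff]
      convert h using 3
      ext y
      simp [Function.uncurry]
  rw [this]
  exact measurable_measure_prodMk_left (hF measurableSet_Ioi) (measurableSet_singleton 0)

theorem lpN_measurable {T Y : Type} [MeasurableSpace T] [MeasurableSpace Y]
    (ν : Measure Y) [SFinite ν] (p : ℝ≥0∞) (F : T → Y → ℝ≥0∞)
    (hF : Measurable (Function.uncurry F)) :
    Measurable fun t => lpN ν p (F t) := by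
  by_cases hp : p = ∞
  · subst hp
    simp only [lpN_top]
    exact measurable_essSup_param ν F hF
  · simp only [lpN_fin ν hp]
    refine Measurable.pow_const ?_ _
    exact Measurable.lintegral_prod_right (f := fun t y => F t y ^ p.toReal) (hF.pow_const _)

theorem lpN_ae {Y : Type} [MeasurableSpace Y] (ν : Measure Y) (p : ℝ≥0∞) (f g : Y → ℝ≥0∞)
    (h : f =ᵐ[ν] g) : lpN ν p f = lpN ν p g := by
  unfold lpN
  have h2 : ∫⁻ a, f a ^ p.toReal ∂ν = ∫⁻ a, g a ^ p.toReal ∂ν :=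
    lintegral_congr_ae (h.mono fun y hy => by simp only [hy])
  rw [essSup_congr_ae h, h2]

theorem lpN_conv_top {T Y : Type} [MeasurableSpace T] [MeasurableSpace Y]
    (ν : Measure Y) [SigmaFinite ν] (F : T → Y → ℝ≥0∞)
    (hF : Measurable (Function.uncurry F)) :
    ∃ f : ℕ → T → Y → ℝ≥0∞, (∀ j, Measurable (Function.uncurry (f j))) ∧
      (∀ j t, lpN ν 1 (f j t) ≤ 1) ∧ ∀ t, lpN ν ∞ (F t) ≤ ⨆ j, ∫⁻ x, f j t x * F t x ∂ν := by
  classical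
  obtain ⟨D, hD, hDd⟩ := TopologicalSpace.exists_countable_dense ℝ≥0∞
  obtain ⟨d, hd⟩ := hD.exists_eq_range hDd.nonempty
  let B : ℕ → ℕ → Set (T × Y) := fun i m =>
    (Function.uncurry F ⁻¹' Ioi (d i)) ∩ (Prod.snd ⁻¹' (spanningSets ν m))
  have hB : ∀ i m, MeasurableSet (B i m) := fun i m =>
    (hF measurableSet_Ioi).inter (measurable_snd (measurableSet_spanningSets ν m))
  let f0 : ℕ → ℕ → T → Y → ℝ≥0∞ := fun i m t y =>
    (B i m).indicator (fun z => (ν (Prod.mk z.1 ⁻¹' B i m))⁻¹) (t, y)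
  have hf0 : ∀ i m, Measurable (Function.uncurry (f0 i m)) := by
    intro i m
    have : Function.uncurry (f0 i m) = (B i m).indicator (fun z => (ν (Prod.mk z.1 ⁻¹' B i m))⁻¹) := by
      ext ⟨t, y⟩; rfl
    rw [this]
    refine Measurable.indicator ?_ (hB i m)
    exact ((measurable_measure_prodMk_left (hB i m)).comp measurable_fst).inv
  have hms : ∀ i m t, MeasurableSet (Prod.mk t ⁻¹' B i m) := fun i m t =>
    measurable_prodMk_left (hB i m)
  have hf0' : ∀ i m t, f0 i m t = (Prod.mk t ⁻¹' B i m).indicator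
      (fun _ => (ν (Prod.mk t ⁻¹' B i m))⁻¹) := by
    intro i m t
    ext y
    simp [f0, indicator]
  have hfin : ∀ i m t, ν (Prod.mk t ⁻¹' B i m) ≠ ∞ := by
    intro i m t
    refine ((measure_mono ?_).trans_lt (measure_spanningSets_lt_top ν m)).ne
    intro y hy
    exact hy.2
  refine ⟨fun j => f0 j.unpair.1 j.unpair.2, fun j => hf0 _ _, ?_, ?_⟩
  · intro j t
    rw [lpN_fin ν one_ne_top]
    simp only [hf0', toReal_one, ENNReal.rpow_one, div_one]
    rw [lintegral_indicator_const (hms _ _ _)]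
    exact ENNReal.inv_mul_le_one _
  · intro t
    rw [lpN_top]
    refine le_of_forall_lt fun c hc => ?_
    obtain ⟨q, hq, hqD⟩ := hDd.exists_between hc
    rw [hd] at hq
    obtain ⟨i, rfl⟩ := hq
    have hpos : ν {y | d i < F t y} ≠ 0 := by
      intro h0
      refine absurd hqD.2 (not_lt.2 ?_)
      refine essSup_le_of_ae_le _ ?_
      rw [EventuallyLE, ae_iff]
      simpa using h0
    have : ∃ m, ν (Prod.mk t ⁻¹' B i m) ≠ 0 := by
      by_contra! hcon
      refine hpos ?_
      have h3 : {y | d i < F t y} ⊆ ⋃ m, Prod.mk t ⁻¹' B i m := by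
        intro y hy
        have : y ∈ ⋃ m, spanningSets ν m := by rw [iUnion_spanningSets]; trivial
        obtain ⟨m, hm⟩ := mem_iUnion.1 this
        exact mem_iUnion.2 ⟨m, hy, hm⟩
      exact measure_mono_null h3 (measure_iUnion_null hcon)
    obtain ⟨m, hm⟩ := this
    refine lt_of_lt_of_le hqD.1 (le_trans ?_ (le_iSup _ (Nat.pair i m)))
    simp only [Nat.unpair_pair, hf0']
    calc d i = ∫⁻ y in Prod.mk t ⁻¹' B i m, (ν (Prod.mk t ⁻¹' B i m))⁻¹ * d i ∂ν := by
          rw [setLIntegral_const, mul_comm, ← mul_assoc, ENNReal.mul_inv_cancel hm (hfin i m t), one_mul]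
      _ ≤ ∫⁻ y in Prod.mk t ⁻¹' B i m, (ν (Prod.mk t ⁻¹' B i m))⁻¹ * F t y ∂ν := by
          refine setLIntegral_mono' (hms _ _ _) fun y hy => ?_
          gcongr
          exact le_of_lt hy.1
      _ = _ := by
          rw [← lintegral_indicator (hms _ _ _)]
          refine lintegral_congr fun y => ?_
          simp [indicator]

theorem lpN_conv_fin {T Y : Type} [MeasurableSpace T] [MeasurableSpace Y]
    (ν : Measure Y) [SigmaFinite ν] {p q : ℝ≥0∞} (hp : p ≠ ∞) (hq : q ≠ ∞)
    (hpq : p.toReal.HolderConjugate q.toReal) (F : T → Y → ℝ≥0∞)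
    (hF : Measurable (Function.uncurry F)) :
    ∃ f : ℕ → T → Y → ℝ≥0∞, (∀ j, Measurable (Function.uncurry (f j))) ∧
      (∀ j t, lpN ν q (f j t) ≤ 1) ∧ ∀ t, lpN ν p (F t) ≤ ⨆ j, ∫⁻ x, f j t x * F t x ∂ν := by
  classical
  have hp0 : 0 < p.toReal := hpq.pos
  have hq0 : 0 < q.toReal := hpq.symm.pos
  let G : ℕ → T → Y → ℝ≥0∞ := fun j t y => (spanningSets ν j).indicator (fun y => min (F t y) j) y
  have hG : ∀ j, Measurable (Function.uncurry (G j)) := by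
    intro j
    have : Function.uncurry (G j) = (Prod.snd ⁻¹' spanningSets ν j).indicator
      (fun z => min (Function.uncurry F z) j) := by
      ext ⟨t, y⟩; simp [G, indicator, Function.uncurry]
    rw [this]
    exact (hF.min measurable_const).indicator (measurable_snd (measurableSet_spanningSets ν j))
  have hGle : ∀ j t y, G j t y ≤ F t y := by
    intro j t y
    simp only [G, indicator]
    split_ifs
    · exact min_le_left _ _
    · exact zero_le
  have hGt : ∀ j t, Measurable (G j t) := fun j t => (hG j).comp measurable_prodMk_left
  have hFt : ∀ t, Measurable (F t) := fun t => hF.comp measurable_prodMk_left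
  have hfin : ∀ j t, ∫⁻ y, G j t y ^ p.toReal ∂ν ≠ ∞ := by
    intro j t
    refine ne_of_lt ?_
    calc ∫⁻ y, G j t y ^ p.toReal ∂ν ≤ ∫⁻ y in spanningSets ν j, (j : ℝ≥0∞) ^ p.toReal ∂ν := by
          rw [← lintegral_indicator (measurableSet_spanningSets ν j)]
          refine lintegral_mono fun y => ?_
          simp only [G, indicator]
          split_ifs
          · gcongr; exact min_le_right _ _
          · simp [hp0]
      _ = (j : ℝ≥0∞) ^ p.toReal * ν (spanningSets ν j) := setLIntegral_const _ _
      _ < ∞ := ENNReal.mul_lt_top (ENNReal.rpow_lt_top_of_nonneg hp0.le (natCast_ne_top j)) (measure_spanningSets_lt_top ν j)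
  let A : ℕ → T → ℝ≥0∞ := fun j t => ∫⁻ y, G j t y ^ p.toReal ∂ν
  have hA : ∀ j, Measurable (A j) := fun j =>
    Measurable.lintegral_prod_right (f := fun t y => G j t y ^ p.toReal) ((hG j).pow_const _)
  refine ⟨fun j t y => (A j t ^ (1 / q.toReal))⁻¹ * G j t y ^ (p.toReal - 1), ?_, ?_, ?_⟩
  · intro j
    exact (((hA j).comp measurable_fst).pow_const _).inv.mul ((hG j).pow_const _)
  · intro j t
    have hint : ∫⁻ y, ((A j t ^ (1 / q.toReal))⁻¹ * G j t y ^ (p.toReal - 1)) ^ q.toReal ∂ν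
        = (A j t)⁻¹ * A j t := by
      calc _ = ∫⁻ y, (A j t)⁻¹ * G j t y ^ p.toReal ∂ν := by
            refine lintegral_congr fun y => ?_
            rw [ENNReal.mul_rpow_of_nonneg _ _ hq0.le, ENNReal.inv_rpow, ← ENNReal.rpow_mul,
              ← ENNReal.rpow_mul, one_div_mul_cancel hq0.ne', ENNReal.rpow_one]
            congr 2
            have := hpq.sub_one_mul_conj
            exact this
        _ = _ := lintegral_const_mul _ ((hGt j t).pow_const _)
    rw [lpN_fin ν hq]
    dsimp only
    rw [hint]
    exact ENNReal.rpow_le_one (ENNReal.inv_mul_le_one _) (by positivity)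
  · intro t
    have key : ∀ j, A j t ^ (1 / p.toReal) ≤
        ∫⁻ y, (A j t ^ (1 / q.toReal))⁻¹ * G j t y ^ (p.toReal - 1) * F t y ∂ν := by
      intro j
      by_cases h0 : A j t = 0
      · rw [h0, ENNReal.zero_rpow_of_pos (by positivity)]; exact zero_le
      have e : A j t ^ (1 / p.toReal) = (A j t ^ (1 / q.toReal))⁻¹ * A j t := by
        rw [← ENNReal.rpow_neg]
        nth_rewrite 3 [← ENNReal.rpow_one (A j t)]
        rw [← ENNReal.rpow_add _ _ h0 (hfin j t)]
        congr 1
        have := hpq.inv_add_inv_eq_one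
        simp only [one_div]
        linarith
      rw [e]
      simp only [A]
      rw [← lintegral_const_mul _ ((hGt j t).pow_const _)]
      refine lintegral_mono fun y => ?_
      dsimp only
      rw [mul_assoc]
      gcongr
      calc G j t y ^ p.toReal = G j t y ^ (p.toReal - 1) * G j t y := by
            nth_rewrite 3 [← ENNReal.rpow_one (G j t y)]
            rw [← ENNReal.rpow_add_of_nonneg _ _ (by have := hpq.lt; linarith) zero_le_one]
            simp
        _ ≤ _ := by gcongr; exact hGle j t y
    refine le_trans ?_ (iSup_mono key)
    rw [lpN_fin ν hp]
    have hsup : ∫⁻ y, F t y ^ p.toReal ∂ν = ⨆ j, A j t := by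
      have : ∀ y, F t y ^ p.toReal = ⨆ j, G j t y ^ p.toReal := by
        intro y
        have h1 : F t y = ⨆ j, G j t y := by
          refine le_antisymm ?_ (iSup_le fun j => hGle j t y)
          refine le_of_forall_lt fun c hc => ?_
          have hcf : c ≠ ∞ := hc.ne_top
          obtain ⟨b, hcb, hbF⟩ := exists_between hc
          obtain ⟨m1, hm1⟩ := ENNReal.exists_nat_gt hbF.ne_top
          have : y ∈ ⋃ m, spanningSets ν m := by rw [iUnion_spanningSets]; trivial
          obtain ⟨m2, hm2⟩ := mem_iUnion.1 this
          refine hcb.trans_le (le_trans ?_ (le_iSup _ (max m1 m2)))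
          have hm3 : y ∈ spanningSets ν (max m1 m2) :=
            monotone_spanningSets ν (le_max_right _ _) hm2
          simp only [G, indicator, hm3, if_true]
          refine le_min hbF.le (hm1.le.trans ?_)
          exact_mod_cast le_max_left m1 m2
        rw [h1]
        exact (ENNReal.orderIsoRpow p.toReal hp0).map_iSup _
      simp_rw [this]
      refine lintegral_iSup (fun j => (hGt j t).pow_const _) ?_
      intro a b hab y
      dsimp only
      have h4 : G a t y ≤ G b t y := by
        simp only [G, indicator]
        split_ifs with ha hb hb
        · refine min_le_min le_rfl ?_
          exact_mod_cast hab
        · exact absurd (monotone_spanningSets ν hab ha) hb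
        · exact zero_le
        · exact le_rfl
      gcongr
    rw [hsup]
    exact ((ENNReal.orderIsoRpow (1 / p.toReal) (by positivity)).map_iSup _).le

theorem lpN_good {Y : Type} [MeasurableSpace Y] (ν : Measure Y) [SigmaFinite ν] {p p' : ℝ≥0∞}
    (hp : 1 < p) (hpp : 1 / p + 1 / p' = 1) : Good ν (lpN ν p) (lpN ν p') := by
  obtain ⟨ht, h1, htop, hconj⟩ := conj_facts hp hpp
  have hq0 : 0 < p'.toReal := by linarith
  refine ⟨fun T _ F hF => lpN_measurable ν p F hF, fun T _ F hF => lpN_measurable ν p' F hF,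
    ?_, lpN_ae ν p, lpN_ae ν p', ?_, ?_, ?_, ?_, ?_⟩
  · intro f g h
    rw [lpN_fin ν ht, lpN_fin ν ht]
    gcongr with y
    exact h y
  · intro f g hf hg
    by_cases hpt : p = ∞
    · rw [htop hpt, hpt, lpN_top, lpN_fin ν one_ne_top]
      simp only [toReal_one, ENNReal.rpow_one, div_one]
      rw [← lintegral_const_mul _ hg]
      refine lintegral_mono_ae ?_
      filter_upwards [ENNReal.ae_le_essSup f] with y hy
      gcongr
    · rw [lpN_fin ν hpt, lpN_fin ν ht]
      exact ENNReal.lintegral_mul_le_Lp_mul_Lq ν (hconj hpt) hf.aemeasurable hg.aemeasurable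
  · intro T _ F hF
    by_cases hpt : p = ∞
    · rw [htop hpt, hpt]
      exact lpN_conv_top ν F hF
    · exact lpN_conv_fin ν hpt ht (hconj hpt) F hF
  · intro f hf h
    rw [lpN_fin ν ht, ENNReal.rpow_lt_top_iff_of_pos (by positivity)] at h
    filter_upwards [ae_lt_top (hf.pow_const _) h.ne] with y hy
    exact (ENNReal.rpow_lt_top_iff_of_pos hq0).1 hy
  · intro f F hf hF hle hfin hlim
    rw [lpN_fin ν ht, ENNReal.rpow_lt_top_iff_of_pos (by positivity)] at hfin
    simp only [lpN_fin ν ht]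
    have := tendsto_lintegral_of_dominated_convergence' (μ := ν) (F := fun j y => f j y ^ p'.toReal)
      (f := fun _ => 0) (fun y => F y ^ p'.toReal)
      (fun j => ((hf j).pow_const _).aemeasurable) (fun j => (hle j).mono fun y hy => by
        dsimp only; gcongr) hfin.ne
      (hlim.mono fun y hy => by
        have := hy.ennrpow_const p'.toReal
        rwa [ENNReal.zero_rpow_of_pos hq0] at this)
    have := this.ennrpow_const (1 / p'.toReal)
    rwa [lintegral_zero, ENNReal.zero_rpow_of_pos (by positivity)] at this
  · intro c f hf
    rw [lpN_fin ν ht, lpN_fin ν ht]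
    simp_rw [ENNReal.mul_rpow_of_nonneg _ _ hq0.le]
    rw [lintegral_const_mul _ (hf.pow_const _), ENNReal.mul_rpow_of_nonneg _ _ (by positivity),
      ← ENNReal.rpow_mul, mul_one_div_cancel hq0.ne', ENNReal.rpow_one]

def gMix {Y : Type} [MeasurableSpace Y] (ν : Measure Y) :
    (n : ℕ) → (Fin n → ℝ≥0∞) → ((Fin n → Y) → ℝ≥0∞) → ℝ≥0∞
  | 0, _, g => g Fin.elim0
  | n + 1, p, g =>
    lpN ν (p (Fin.last n)) fun t =>
      gMix ν n (fun i => p i.castSucc) fun x => g (Fin.snoc (α := fun _ => Y) x t)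

theorem mixedE_eq (n : ℕ) : mixedE n = gMix (volume : Measure ℝ) n := by
  induction n with
  | zero => rfl
  | succ n ih =>
    funext p g
    simp only [mixedE, gMix, ih]
    rfl

theorem lpSum_eq : lpSum = lpN (Measure.count : Measure ℤ) := by
  funext p g
  simp only [lpSum, lpN, essSup_count, lintegral_count]

theorem mixedSeq_eq (n : ℕ) : mixedSeq n = gMix (Measure.count : Measure ℤ) n := by
  induction n with
  | zero => rfl
  | succ n ih =>
    funext p g
    simp only [mixedSeq, gMix, ih, lpSum_eq]

theorem gMix_good {Y : Type} [MeasurableSpace Y] (ν : Measure Y) [SigmaFinite ν] (n : ℕ)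
    (p p' : Fin n → ℝ≥0∞) (hp : ∀ i, 1 < p i) (hpp : ∀ i, 1 / p i + 1 / p' i = 1) :
    Good (Measure.pi fun _ : Fin n => ν) (gMix ν n p) (gMix ν n p') := by
  induction n with
  | zero =>
    rw [Measure.pi_of_empty _ Fin.elim0]
    have hi : ∀ f : (Fin 0 → Y) → ℝ≥0∞, ∫⁻ x, f x ∂(Measure.dirac Fin.elim0) = f Fin.elim0 := by
      intro f
      have : f = fun _ => f Fin.elim0 := by
        funext x; congr 1; exact Subsingleton.elim _ _
      rw [this]; simp
    have hae : ∀ P : (Fin 0 → Y) → Prop,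
        (∀ᵐ x ∂(Measure.dirac (Fin.elim0 : Fin 0 → Y)), P x) → P Fin.elim0 := by
      intro P h
      obtain ⟨x, hx⟩ := h.exists
      rwa [Subsingleton.elim Fin.elim0 x]
    refine ⟨?_, ?_, ?_, ?_, ?_, ?_, ?_, ?_, ?_, ?_⟩
    · intro T _ F hF
      exact hF.comp measurable_prodMk_right
    · intro T _ F hF
      exact hF.comp measurable_prodMk_right
    · intro f g h
      exact h _
    · intro f g h
      exact hae _ h
    · intro f g h
      exact hae _ h
    · intro f g hf hg
      rw [hi]
      exact le_rfl
    · intro T _ F hF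
      refine ⟨fun _ _ _ => 1, fun _ => measurable_const, fun _ _ => le_rfl, fun t => ?_⟩
      simp only [one_mul]
      refine le_trans ?_ (le_iSup _ 0)
      rw [hi]
      exact le_rfl
    · intro f hf h
      refine Eventually.of_forall fun x => ?_
      rwa [Subsingleton.elim x Fin.elim0]
    · intro f F hf hF hle hfin hlim
      exact hae _ hlim
    · intro c f hf
      exact le_rfl
  | succ n ih =>
    have hg := (ih (fun i => p i.castSucc) (fun i => p' i.castSucc) (fun i => hp _)
      (fun i => hpp _)).prod (lpN_good ν (hp (Fin.last n)) (hpp (Fin.last n)))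
    have he := measurePreserving_piFinSuccAbove (fun _ : Fin (n+1) => ν) (Fin.last n)
    have hs : ∀ t x, (MeasurableEquiv.piFinSuccAbove (fun _ : Fin (n+1) => Y) (Fin.last n)).symm (t, x)
        = Fin.snoc (α := fun _ => Y) x t := by
      intro t x
      exact Fin.insertNth_last' _ _
    have := hg.transport _ he
    simp only [hs] at this
    exact this

theorem lpN_const_mul {Y : Type} [MeasurableSpace Y] (ν : Measure Y) {p : ℝ≥0∞} (hp : p ≠ ∞)
    (hp0 : 0 < p.toReal) {c : ℝ≥0∞} (hc : c ≠ ∞) (f : Y → ℝ≥0∞) :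
    lpN ν p (fun y => c * f y) = c * lpN ν p f := by
  rw [lpN_fin ν hp, lpN_fin ν hp]
  simp_rw [ENNReal.mul_rpow_of_nonneg _ _ hp0.le]
  rw [lintegral_const_mul' _ _ (ENNReal.rpow_ne_top_of_nonneg hp0.le hc),
    ENNReal.mul_rpow_of_nonneg _ _ (by positivity),
    ← ENNReal.rpow_mul, mul_one_div_cancel hp0.ne', ENNReal.rpow_one]

theorem gMix_const_mul {Y : Type} [MeasurableSpace Y] (ν : Measure Y) (n : ℕ)
    (p : Fin n → ℝ≥0∞) (hp : ∀ i, p i ≠ ∞ ∧ 0 < (p i).toReal)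
    {c : ℝ≥0∞} (hc : c ≠ ∞) (f : (Fin n → Y) → ℝ≥0∞) :
    gMix ν n p (fun y => c * f y) = c * gMix ν n p f := by
  induction n with
  | zero => rfl
  | succ n ih =>
    simp only [gMix]
    simp_rw [ih (fun i => p i.castSucc) (fun i => hp _)]
    exact lpN_const_mul ν (hp _).1 (hp _).2 hc _

theorem gMix_prod {Y : Type} [MeasurableSpace Y] (ν : Measure Y) (n : ℕ)
    (p : Fin n → ℝ≥0∞) (hp : ∀ i, p i ≠ ∞ ∧ 0 < (p i).toReal) (u : Fin n → Y → ℝ≥0∞)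
    (hu : ∀ i y, u i y ≠ ∞) (hfin : ∀ i, lpN ν (p i) (u i) ≠ ∞) :
    gMix ν n p (fun y => ∏ i, u i (y i)) = ∏ i, lpN ν (p i) (u i) := by
  induction n with
  | zero => simp [gMix]
  | succ n ih =>
    simp only [gMix, Fin.prod_univ_castSucc, Fin.snoc_castSucc, Fin.snoc_last]
    simp_rw [mul_comm _ (u (Fin.last n) _)]
    have : ∀ t, (gMix ν n (fun i => p i.castSucc) fun x =>
        u (Fin.last n) t * ∏ i : Fin n, u i.castSucc (x i)) =
        (∏ i : Fin n, lpN ν (p i.castSucc) (u i.castSucc)) * u (Fin.last n) t := by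
      intro t
      rw [gMix_const_mul ν n _ (fun i => hp _) (hu _ _),
        ih (fun i => p i.castSucc) (fun i => hp _) (fun i => u i.castSucc) (fun i => hu _)
          (fun i => hfin _), mul_comm]
    simp_rw [this]
    exact lpN_const_mul ν (hp _).1 (hp _).2 (ENNReal.prod_ne_top fun i _ => hfin _) _

theorem lpN_scale {p : ℝ≥0∞} (hp : p ≠ ∞) (hp0 : 0 < p.toReal) {r : ℝ} (hr : 0 < r)
    (f : ℝ → ℝ≥0∞) :
    lpN volume p (fun t => f (r * t)) = ENNReal.ofReal (r ^ (-(1 / p).toReal)) * lpN volume p f := by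
  rw [lpN_fin _ hp, lpN_fin _ hp]
  have h1 : ∫⁻ t, f (r * t) ^ p.toReal = ENNReal.ofReal r⁻¹ * ∫⁻ t, f t ^ p.toReal := by
    have hm : MeasurableEmbedding (fun t : ℝ => r * t) :=
      (Homeomorph.mulLeft₀ r hr.ne').measurableEmbedding
    rw [← hm.lintegral_map (fun t => f t ^ p.toReal), Real.map_volume_mul_left hr.ne',
      lintegral_smul_measure, abs_of_pos (inv_pos.2 hr)]
    rfl
  rw [h1, ENNReal.mul_rpow_of_nonneg _ _ (by positivity),
    ENNReal.ofReal_rpow_of_pos (inv_pos.2 hr)]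
  congr 2
  rw [Real.inv_rpow hr.le, ← Real.rpow_neg hr.le]
  simp

theorem mixedE_scale (n : ℕ) (p : Fin n → ℝ≥0∞) (hp : ∀ i, p i ≠ ∞ ∧ 0 < (p i).toReal)
    {r : ℝ} (hr : 0 < r) (f : (Fin n → ℝ) → ℝ≥0∞) :
    gMix volume n p (fun x => f (r • x)) = ENNReal.ofReal (r ^ (-invSum n p)) * gMix volume n p f := by
  induction n with
  | zero => simp [gMix, invSum]; congr 1
  | succ n ih =>
    simp only [gMix]
    have hs : ∀ (x : Fin n → ℝ) (t : ℝ), r • (Fin.snoc (α := fun _ => ℝ) x t : Fin (n+1) → ℝ) =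
        Fin.snoc (α := fun _ => ℝ) (r • x) (r * t) := by
      intro x t
      funext i
      refine Fin.lastCases ?_ (fun i => ?_) i <;> simp
    simp_rw [hs]
    have : ∀ t, (gMix volume n (fun i => p i.castSucc) fun x : Fin n → ℝ =>
        f (Fin.snoc (α := fun _ => ℝ) (r • x) (r * t))) =
        ENNReal.ofReal (r ^ (-invSum n (fun i => p i.castSucc))) *
        gMix volume n (fun i => p i.castSucc) fun x => f (Fin.snoc (α := fun _ => ℝ) x (r * t)) :=
      fun t => ih (fun i => p i.castSucc) (fun i => hp _)
        (fun x => f (Fin.snoc (α := fun _ => ℝ) x (r * t)))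
    simp_rw [this]
    rw [lpN_const_mul volume (hp _).1 (hp _).2 ENNReal.ofReal_ne_top]
    rw [lpN_scale (hp _).1 (hp _).2 hr (fun t => gMix volume n (fun i => p i.castSucc)
      fun x => f (Fin.snoc (α := fun _ => ℝ) x t)), ← mul_assoc, ← ENNReal.ofReal_mul (by positivity),
      ← Real.rpow_add hr]
    congr 3
    simp only [invSum, Fin.sum_univ_castSucc]
    ring

/-- big norm on `ℤⁿ × ℝⁿ` -/
def bigN (n : ℕ) (p s : Fin n → ℝ≥0∞) (F : (Fin n → ℤ) × (Fin n → ℝ) → ℝ≥0∞) : ℝ≥0∞ :=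
  mixedSeq n s fun k => mixedE n p fun x => F (k, x)

def kap (n : ℕ) : Measure (Fin n → ℤ) := Measure.pi fun _ => Measure.count

instance (n : ℕ) : SigmaFinite (kap n) := by unfold kap; infer_instance

theorem kap_singleton (n : ℕ) (k : Fin n → ℤ) : kap n {k} = 1 := by
  unfold kap
  rw [Measure.pi_singleton]
  simp

theorem big_good (n : ℕ) (p s p' s' : Fin n → ℝ≥0∞) (hp : ∀ i, 1 < p i) (hs : ∀ i, 1 < s i)
    (hp' : ∀ i, 1 / p i + 1 / p' i = 1) (hs' : ∀ i, 1 / s i + 1 / s' i = 1) :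
    Good ((kap n).prod (volume : Measure (Fin n → ℝ))) (bigN n p s) (bigN n p' s') := by
  have h1 := gMix_good (volume : Measure ℝ) n p p' hp hp'
  have h2 := gMix_good (Measure.count : Measure ℤ) n s s' hs hs'
  have := h1.prod h2
  unfold bigN
  simp only [mixedE_eq, mixedSeq_eq]
  exact this

/-- embedding of functions on `ℝⁿ` -/
def emb (n : ℕ) (r : ℝ) (u : (Fin n → ℝ) → ℝ≥0∞) (z : (Fin n → ℤ) × (Fin n → ℝ)) : ℝ≥0∞ :=
  (qcube n r z.1).indicator u z.2

def fl (n : ℕ) (r : ℝ) (x : Fin n → ℝ) : Fin n → ℤ := fun i => ⌊x i / r⌋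

theorem mem_qcube {n : ℕ} {r : ℝ} (hr : 0 < r) (k : Fin n → ℤ) (x : Fin n → ℝ) :
    x ∈ qcube n r k ↔ k = fl n r x := by
  simp only [qcube, mem_ofPred_eq, fl, funext_iff]
  refine forall_congr' fun i => ?_
  rw [eq_comm, Int.floor_eq_iff, le_div_iff₀ hr, div_lt_iff₀ hr, mul_comm r, mul_comm r]

theorem measurable_fl (n : ℕ) (r : ℝ) : Measurable (fl n r) := by
  unfold fl
  fun_prop

theorem discNormR_eq (n : ℕ) (p s : Fin n → ℝ≥0∞) (r : ℝ) (f : (Fin n → ℝ) → ℝ) :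
    discNormR n p s r f = bigN n p s (emb n r fun x => ‖f x‖ₑ) := by
  unfold discNormR bigN mixedLp emb
  congr 1
  funext k
  congr 1
  funext x
  by_cases h : x ∈ qcube n r k <;> simp [h, enorm_eq_nnnorm]

theorem emb_measurable (n : ℕ) {r : ℝ} (hr : 0 < r) (u : (Fin n → ℝ) → ℝ≥0∞) (hu : Measurable u) :
    Measurable (emb n r u) := by
  have : emb n r u = {z : (Fin n → ℤ) × (Fin n → ℝ) | z.1 = fl n r z.2}.indicator (fun z => u z.2) := by
    ext z
    simp only [emb, indicator, mem_qcube hr, mem_ofPred_eq]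
  rw [this]
  refine Measurable.indicator (by fun_prop) ?_
  exact measurableSet_eq_fun measurable_fst ((measurable_fl n r).comp measurable_snd)

theorem emb_ae (n : ℕ) (r : ℝ) (u v : (Fin n → ℝ) → ℝ≥0∞) (h : u =ᵐ[volume] v) :
    emb n r u =ᵐ[(kap n).prod volume] emb n r v := by
  have : ∀ᵐ z ∂((kap n).prod (volume : Measure (Fin n → ℝ))), u z.2 = v z.2 :=
    Measure.quasiMeasurePreserving_snd.ae h
  filter_upwards [this] with z hz
  simp only [emb, indicator, hz]

theorem emb_lintegral (n : ℕ) {r : ℝ} (hr : 0 < r) (u : (Fin n → ℝ) → ℝ≥0∞) (hu : Measurable u)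
    (G : (Fin n → ℤ) × (Fin n → ℝ) → ℝ≥0∞) (hG : Measurable G) :
    ∫⁻ z, emb n r u z * G z ∂((kap n).prod volume) = ∫⁻ x, u x * G (fl n r x, x) := by
  rw [lintegral_prod_symm (fun z => emb n r u z * G z) ((emb_measurable n hr u hu).mul hG).aemeasurable]
  refine lintegral_congr fun x => ?_
  rw [lintegral_countable', tsum_eq_single (fl n r x)]
  · simp [emb, kap_singleton, (mem_qcube hr (fl n r x) x).2 rfl]
  · intro k hk
    have : x ∉ qcube n r k := fun h => hk ((mem_qcube hr _ _).1 h)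
    simp [emb, this]

structure Cfg (n : ℕ) (p s p' s' : Fin n → ℝ≥0∞) : Prop where
  hp : ∀ i, 1 < p i
  hs : ∀ i, 1 < s i
  hp' : ∀ i, 1 / p i + 1 / p' i = 1
  hs' : ∀ i, 1 / s i + 1 / s' i = 1

theorem Cfg.good {n : ℕ} {p s p' s' : Fin n → ℝ≥0∞} (h : Cfg n p s p' s') :
    Good ((kap n).prod (volume : Measure (Fin n → ℝ))) (bigN n p s) (bigN n p' s') :=
  big_good n p s p' s' h.hp h.hs h.hp' h.hs'

theorem Cfg.p_fin {n : ℕ} {p s p' s' : Fin n → ℝ≥0∞} (h : Cfg n p s p' s') (i : Fin n) :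
    p' i ≠ ∞ ∧ 0 < (p' i).toReal :=
  have := conj_facts (h.hp i) (h.hp' i)
  ⟨this.1, by linarith [this.2.1]⟩

theorem Cfg.s_fin {n : ℕ} {p s p' s' : Fin n → ℝ≥0∞} (h : Cfg n p s p' s') (i : Fin n) :
    s' i ≠ ∞ ∧ 0 < (s' i).toReal :=
  have := conj_facts (h.hs i) (h.hs' i)
  ⟨this.1, by linarith [this.2.1]⟩

section
variable {n : ℕ} {p s p' s' : Fin n → ℝ≥0∞}

theorem Cfg.norm_ae (h : Cfg n p s p' s') (r : ℝ) {f g : (Fin n → ℝ) → ℝ} (hfg : f =ᵐ[volume] g) :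
    discNormR n p s r f = discNormR n p s r g := by
  rw [discNormR_eq, discNormR_eq]
  exact h.good.ae _ _ (emb_ae n r _ _ (hfg.mono fun x hx => by simp only [hx]))

theorem Cfg.norm_ae' (h : Cfg n p s p' s') (r : ℝ) {f g : (Fin n → ℝ) → ℝ} (hfg : f =ᵐ[volume] g) :
    discNormR n p' s' r f = discNormR n p' s' r g := by
  rw [discNormR_eq, discNormR_eq]
  exact h.good.ae' _ _ (emb_ae n r _ _ (hfg.mono fun x hx => by simp only [hx]))

theorem emb_mono (n : ℕ) (r : ℝ) {u v : (Fin n → ℝ) → ℝ≥0∞} (h : ∀ x, u x ≤ v x) :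
    emb n r u ≤ emb n r v := fun z => indicator_le_indicator (h z.2)

theorem Cfg.norm_mono' (h : Cfg n p s p' s') (r : ℝ) {f g : (Fin n → ℝ) → ℝ}
    (hfg : ∀ x, |f x| ≤ |g x|) :
    discNormR n p' s' r f ≤ discNormR n p' s' r g := by
  rw [discNormR_eq, discNormR_eq]
  refine h.good.mono' _ _ (emb_mono n r fun x => ?_)
  rw [Real.enorm_eq_ofReal_abs, Real.enorm_eq_ofReal_abs]
  exact ENNReal.ofReal_le_ofReal (hfg x)

theorem Cfg.norm_smul' (h : Cfg n p s p' s') (r : ℝ) (c : ℝ) (f : (Fin n → ℝ) → ℝ) :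
    discNormR n p' s' r (fun x => c * f x) = ENNReal.ofReal |c| * discNormR n p' s' r f := by
  rw [discNormR_eq, discNormR_eq]
  simp only [bigN, mixedE_eq, mixedSeq_eq]
  have : ∀ (k : Fin n → ℤ) x, emb n r (fun x => ‖c * f x‖ₑ) (k, x) =
      ENNReal.ofReal |c| * emb n r (fun x => ‖f x‖ₑ) (k, x) := by
    intro k x
    simp only [emb, enorm_mul, ← Real.enorm_eq_ofReal_abs]
    by_cases hx : x ∈ qcube n r k <;> simp [hx]
  simp_rw [this]
  simp_rw [gMix_const_mul volume n p' h.p_fin ENNReal.ofReal_ne_top]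
  exact gMix_const_mul _ n s' h.s_fin ENNReal.ofReal_ne_top _

theorem Cfg.norm_scale' (h : Cfg n p s p' s') {r : ℝ} (hr : 0 < r) (f : (Fin n → ℝ) → ℝ) :
    discNorm n p' s' (fun x => f (r • x)) =
      ENNReal.ofReal (r ^ (-invSum n p')) * discNormR n p' s' r f := by
  rw [discNorm, discNormR_eq, discNormR_eq]
  simp only [bigN, mixedE_eq, mixedSeq_eq]
  have : ∀ (k : Fin n → ℤ) x, emb n 1 (fun x => ‖f (r • x)‖ₑ) (k, x) =
      emb n r (fun x => ‖f x‖ₑ) (k, r • x) := by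
    intro k x
    have : x ∈ qcube n 1 k ↔ r • x ∈ qcube n r k := by
      rw [mem_qcube one_pos, mem_qcube hr]
      have : fl n r (r • x) = fl n 1 x := by
        funext i; simp [fl, mul_div_cancel_left₀ _ hr.ne']
      rw [this]
    by_cases hx : x ∈ qcube n 1 k
    · simp [emb, hx, this.1 hx]
    · simp [emb, hx, mt this.2 hx]
  simp_rw [this]
  have h2 : ∀ k : Fin n → ℤ, (gMix volume n p' fun x => emb n r (fun x => ‖f x‖ₑ) (k, r • x)) =
      ENNReal.ofReal (r ^ (-invSum n p')) *
        gMix volume n p' fun x => emb n r (fun x => ‖f x‖ₑ) (k, x) := fun k =>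
    mixedE_scale n p' h.p_fin hr (fun x => emb n r (fun x => ‖f x‖ₑ) (k, x))
  simp_rw [h2]
  exact gMix_const_mul _ n s' h.s_fin ENNReal.ofReal_ne_top _

theorem Cfg.holder (h : Cfg n p s p' s') {r : ℝ} (hr : 0 < r) {g f : (Fin n → ℝ) → ℝ}
    (hg : AEMeasurable g volume) (hf : AEMeasurable f volume) :
    ∫⁻ x, ‖f x‖ₑ * ‖g x‖ₑ ≤ discNormR n p s r g * discNormR n p' s' r f := by
  rw [h.norm_ae r hg.ae_eq_mk, h.norm_ae' r hf.ae_eq_mk, discNormR_eq, discNormR_eq]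
  have hgm : Measurable fun x => ‖hg.mk g x‖ₑ := hg.measurable_mk.enorm
  have hfm : Measurable fun x => ‖hf.mk f x‖ₑ := hf.measurable_mk.enorm
  refine le_trans (le_of_eq ?_) (h.good.holder _ _ (emb_measurable n hr _ hgm)
    (emb_measurable n hr _ hfm))
  rw [emb_lintegral n hr _ hgm _ (emb_measurable n hr _ hfm)]
  refine lintegral_congr_ae ?_
  filter_upwards [hg.ae_eq_mk, hf.ae_eq_mk] with x h1 h2
  rw [h1, h2, mul_comm]
  simp [emb, (mem_qcube hr (fl n r x) x).2 rfl]

theorem Cfg.conv (h : Cfg n p s p' s') {r : ℝ} (hr : 0 < r) {g : (Fin n → ℝ) → ℝ}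
    (hg : AEMeasurable g volume) :
    ∃ u : ℕ → (Fin n → ℝ) → ℝ≥0∞, (∀ j, Measurable (u j)) ∧
      (∀ j, bigN n p' s' (emb n r (u j)) ≤ 1) ∧
      discNormR n p s r g ≤ ⨆ j, ∫⁻ x, u j x * ‖g x‖ₑ := by
  have hgm : Measurable fun x => ‖hg.mk g x‖ₑ := hg.measurable_mk.enorm
  obtain ⟨f, fm, f1, fs⟩ := h.good.conv Unit (fun _ => emb n r fun x => ‖hg.mk g x‖ₑ)
    ((emb_measurable n hr _ hgm).comp measurable_snd)
  have fm' : ∀ j, Measurable (f j ()) := fun j => (fm j).comp measurable_prodMk_left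
  refine ⟨fun j x => f j () (fl n r x, x), ?_, ?_, ?_⟩
  · intro j
    exact (fm' j).comp ((measurable_fl n r).prodMk measurable_id)
  · intro j
    refine le_trans (h.good.mono' _ _ fun z => ?_) (f1 j ())
    simp only [emb, indicator, mem_qcube hr]
    split_ifs with hz
    · rw [← hz]
    · exact zero_le
  · rw [h.norm_ae r hg.ae_eq_mk, discNormR_eq]
    refine (fs ()).trans (iSup_mono fun j => le_of_eq ?_)
    simp_rw [mul_comm (f j () _)]
    rw [emb_lintegral n hr _ hgm _ (fm' j)]
    refine lintegral_congr_ae ?_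
    filter_upwards [hg.ae_eq_mk] with x h1
    rw [← h1, mul_comm]

theorem Cfg.dct (h : Cfg n p s p' s') {r : ℝ} (hr : 0 < r) (f : ℕ → (Fin n → ℝ) → ℝ)
    (F : (Fin n → ℝ) → ℝ) (hf : ∀ j, Measurable (f j)) (hF : Measurable F)
    (hle : ∀ j x, |f j x| ≤ |F x|) (hfin : discNormR n p' s' r F < ∞)
    (hlim : ∀ x, Tendsto (fun j => f j x) atTop (𝓝 0)) :
    Tendsto (fun j => discNormR n p' s' r (f j)) atTop (𝓝 0) := by
  simp only [discNormR_eq] at hfin ⊢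
  refine h.good.dct' _ _ (fun j => emb_measurable n hr _ (hf j).enorm)
    (emb_measurable n hr _ hF.enorm) (fun j => Eventually.of_forall ?_) hfin
    (Eventually.of_forall fun z => ?_)
  · refine emb_mono n r fun x => ?_
    rw [Real.enorm_eq_ofReal_abs, Real.enorm_eq_ofReal_abs]
    exact ENNReal.ofReal_le_ofReal (hle j x)
  · simp only [emb, indicator]
    split_ifs
    · have := (hlim z.2).enorm
      simpa using this
    · exact tendsto_const_nhds

theorem Cfg.weight (h : Cfg n p s p' s') : ∃ w : (Fin n → ℝ) → ℝ, Measurable w ∧ (∀ x, 0 < w x) ∧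
    (∀ x, w x ≤ 1) ∧ (∀ K, IsCompact K → ∃ c > 0, ∀ x ∈ K, c ≤ w x) ∧
    discNormR n p' s' 1 w < ∞ := by
  obtain ⟨u, u0, um, ui⟩ := exists_pos_lintegral_lt_of_sigmaFinite (Measure.count : Measure ℤ)
    (ε := 1) one_ne_zero
  have u1 : ∀ k, u k ≤ 1 := by
    intro k
    have h1 : (u k : ℝ≥0∞) ≤ ∫⁻ k, u k ∂Measure.count := by
      rw [lintegral_count]; exact ENNReal.le_tsum k
    exact_mod_cast (h1.trans ui.le)
  refine ⟨fun x => ∏ i, (u ⌊x i⌋ : ℝ), ?_, ?_, ?_, ?_, ?_⟩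
  · refine Finset.measurable_prod _ fun i _ => ?_
    exact (measurable_coe_nnreal_real.comp um).comp (Int.measurable_floor.comp (measurable_pi_apply i))
  · intro x
    exact Finset.prod_pos fun i _ => u0 _
  · intro x
    exact Finset.prod_le_one (fun i _ => NNReal.coe_nonneg _) (fun i _ => u1 _)
  · intro K hK
    obtain ⟨R, hR⟩ := hK.isBounded.exists_norm_le
    have hne : (Finset.Icc (⌊-R⌋) (⌊R⌋ ⊔ ⌊-R⌋)).Nonempty := Finset.nonempty_Icc.2 le_sup_right
    obtain ⟨m, hm, hmin⟩ := Finset.exists_min_image _ u hne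
    refine ⟨∏ i : Fin n, (u m : ℝ), Finset.prod_pos fun i _ => u0 _, fun x hx => ?_⟩
    refine Finset.prod_le_prod (fun i _ => NNReal.coe_nonneg _) fun i _ => ?_
    have hxi : |x i| ≤ R := (norm_le_pi_norm x i).trans (hR x hx)
    have := hmin ⌊x i⌋ (Finset.mem_Icc.2 ⟨Int.floor_mono (abs_le.1 hxi).1,
      (Int.floor_mono (abs_le.1 hxi).2).trans le_sup_left⟩)
    exact_mod_cast this
  · rw [discNormR_eq]
    simp only [bigN, mixedE_eq, mixedSeq_eq]
    have hemb : ∀ (k : Fin n → ℤ) x, emb n 1 (fun x => ‖∏ i, (u ⌊x i⌋ : ℝ)‖ₑ) (k, x) =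
        (∏ i, (u (k i) : ℝ≥0∞)) * ∏ i, (Ico (k i : ℝ) (k i + 1)).indicator (fun _ => (1 : ℝ≥0∞)) (x i) := by
      intro k x
      simp only [emb]
      by_cases hx : x ∈ qcube n 1 k
      · have h1 := (mem_qcube one_pos k x).1 hx
        have h2 : ∀ i, ⌊x i⌋ = k i := fun i => by rw [h1]; simp [fl]
        have h3 : ∀ i, x i ∈ Ico (k i : ℝ) (k i + 1) := fun i => Int.floor_eq_iff.1 (h2 i)
        simp only [indicator_of_mem hx, indicator_of_mem (h3 _), Finset.prod_const_one, mul_one, h2]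
        rw [Real.enorm_eq_ofReal_abs, abs_of_nonneg (Finset.prod_nonneg fun i _ => NNReal.coe_nonneg _),
          ENNReal.ofReal_prod_of_nonneg (fun i _ => NNReal.coe_nonneg _)]
        simp
      · rw [indicator_of_notMem hx]
        have : ∃ i, x i ∉ Ico (k i : ℝ) (k i + 1) := by
          by_contra! hcon
          refine hx fun i => ?_
          simpa using hcon i
        obtain ⟨i, hi⟩ := this
        have h0 : ∏ i, (Ico (k i : ℝ) (k i + 1)).indicator (fun _ => (1 : ℝ≥0∞)) (x i) = 0 :=
          Finset.prod_eq_zero (i := i) (Finset.mem_univ i) (indicator_of_notMem hi _)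
        rw [h0, mul_zero]
    simp_rw [hemb]
    have hl1 : ∀ (k : Fin n → ℤ) i, lpN volume (p' i)
        ((Ico (k i : ℝ) (k i + 1)).indicator (fun _ => (1 : ℝ≥0∞))) = 1 := by
      intro k i
      rw [lpN_fin _ (h.p_fin i).1]
      have : ∀ t, (Ico (k i : ℝ) (k i + 1)).indicator (fun _ => (1 : ℝ≥0∞)) t ^ (p' i).toReal =
        (Ico (k i : ℝ) (k i + 1)).indicator (fun _ => (1 : ℝ≥0∞)) t := by
        intro t
        by_cases ht : t ∈ Ico (k i : ℝ) (k i + 1)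
        · simp [ht]
        · rw [indicator_of_notMem ht, ENNReal.zero_rpow_of_pos (h.p_fin i).2]
      simp_rw [this]
      rw [lintegral_indicator_const measurableSet_Ico]
      simp
    have hl2 : ∀ k : Fin n → ℤ, (gMix volume n p' fun x => (∏ i, (u (k i) : ℝ≥0∞)) *
        ∏ i, (Ico (k i : ℝ) (k i + 1)).indicator (fun _ => (1 : ℝ≥0∞)) (x i)) =
        ∏ i, (u (k i) : ℝ≥0∞) := by
      intro k
      rw [gMix_const_mul volume n p' h.p_fin (ENNReal.prod_ne_top fun i _ => coe_ne_top),
        gMix_prod volume n p' h.p_fin (fun i => (Ico (k i : ℝ) (k i + 1)).indicator (fun _ => (1 : ℝ≥0∞)))]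
      · simp [hl1]
      · intro i y
        by_cases ht : y ∈ Ico (k i : ℝ) (k i + 1) <;> simp [ht]
      · intro i; rw [hl1]; exact one_ne_top
    simp_rw [hl2]
    have hl3 : ∀ i, lpN Measure.count (s' i) (fun k : ℤ => (u k : ℝ≥0∞)) ≠ ∞ := by
      intro i
      rw [lpN_fin _ (h.s_fin i).1]
      refine ENNReal.rpow_ne_top_of_nonneg (by have := (h.s_fin i).2; positivity) ?_
      refine ne_of_lt (lt_of_le_of_lt (lintegral_mono fun k => ?_) (ui.trans one_lt_top))
      have h1 : 1 ≤ (s' i).toReal := (conj_facts (h.hs i) (h.hs' i)).2.1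
      exact ENNReal.rpow_le_self_of_le_one (by exact_mod_cast u1 k) h1
    rw [gMix_prod Measure.count n s' h.s_fin (fun i k => (u k : ℝ≥0∞)) (fun i k => coe_ne_top) hl3]
    exact ENNReal.prod_lt_top fun i _ => (hl3 i).lt_top

end

section
variable {n : ℕ} {p s p' s' : Fin n → ℝ≥0∞}
theorem toReal_conj {a b : ℝ≥0∞} (h : 1 / a + 1 / b = 1) :
    (1 / a).toReal + (1 / b).toReal = 1 := by
  have h1 : 1 / a ≠ ∞ := fun h' => by simp [h'] at h
  have h2 : 1 / b ≠ ∞ := fun h' => by simp [h'] at h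
  rw [← ENNReal.toReal_add h1 h2, h]; simp

theorem Cfg.exp_neg (h : Cfg n p s p' s') {α α' : ℝ≥0∞} (hα : 1 / α + 1 / α' = 1) :
    (n : ℝ) * (1 / α').toReal - invSum n p' = -((n : ℝ) * (1 / α).toReal - invSum n p) := by
  have h1 : invSum n p + invSum n p' = n := by
    unfold invSum
    rw [← Finset.sum_add_distrib]
    simp only [fun i => toReal_conj (h.hp' i)]
    simp
  have h2 := toReal_conj hα
  have h3 : (n : ℝ) * (1 / α).toReal + n * (1 / α').toReal = n := by
    rw [← mul_add, h2, mul_one]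
  linarith

theorem locInt_scale {n : ℕ} {b : (Fin n → ℝ) → ℝ} (hb : LocallyIntegrable b volume) {r : ℝ}
    (hr : r ≠ 0) : LocallyIntegrable (fun x => b (r • x)) volume := by
  rw [locallyIntegrable_iff]
  intro K hK
  have hK' : IsCompact ((fun x : Fin n → ℝ => r • x) '' K) :=
    hK.image (continuous_const_smul r)
  have h1 := hb.integrableOn_isCompact hK'
  rw [← integrable_indicator_iff hK'.measurableSet, ← integrable_comp_smul_iff volume _ hr] at h1
  rw [← integrable_indicator_iff hK.measurableSet]
  refine h1.congr (Eventually.of_forall fun x => ?_)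
  have : r • x ∈ ((fun x : Fin n → ℝ => r • x) '' K) ↔ x ∈ K :=
    (smul_right_injective _ hr).mem_set_image (f := fun x : Fin n → ℝ => r • x)
  by_cases hx : x ∈ K
  · simp only [Set.indicator_of_mem (this.2 hx), Set.indicator_of_mem hx]
  · simp only [Set.indicator_of_notMem (fun h => hx (this.1 h)), Set.indicator_of_notMem hx]

theorem locInt_dil {n : ℕ} {b : (Fin n → ℝ) → ℝ} (hb : LocallyIntegrable b volume) {r : ℝ}
    (hr : 0 < r) (α : ℝ≥0∞) : LocallyIntegrable (dil n α r b) volume := by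
  have := (locInt_scale hb (inv_ne_zero hr.ne')).smul (r ^ (-((n : ℝ) * (1 / α).toReal)))
  exact this

theorem Cfg.norm_unscale (h : Cfg n p s p' s') (α' : ℝ≥0∞) {r : ℝ} (hr : 0 < r)
    (b : (Fin n → ℝ) → ℝ) (c : ℝ) :
    discNorm n p' s' (fun x => (c * r ^ ((n : ℝ) * (1 / α').toReal)) * b (r • x)) =
      ENNReal.ofReal |c| * (ENNReal.ofReal (r ^ ((n : ℝ) * (1 / α').toReal - invSum n p')) *
        discNormR n p' s' r b) := by
  have h1 := h.norm_smul' 1 (c * r ^ ((n : ℝ) * (1 / α').toReal)) (fun x => b (r • x))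
  have h2 := h.norm_scale' hr b
  unfold discNorm at *
  rw [h1, h2, abs_mul, ENNReal.ofReal_mul (abs_nonneg _), abs_of_pos (Real.rpow_pos_of_pos hr _),
    sub_eq_add_neg, Real.rpow_add hr, ENNReal.ofReal_mul (Real.rpow_pos_of_pos hr _).le]
  ring

theorem undil {n : ℕ} {α' : ℝ≥0∞} {r : ℝ} (hr : 0 < r) (g : (Fin n → ℝ) → ℝ) :
    (fun x => (1 * r ^ ((n : ℝ) * (1 / α').toReal)) * dil n α' r g (r • x)) = g := by
  funext x
  unfold dil
  rw [smul_smul, inv_mul_cancel₀ hr.ne', one_smul, one_mul, ← mul_assoc, ← Real.rpow_add hr]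
  simp

theorem Cfg.dil_normR (h : Cfg n p s p' s') (α' : ℝ≥0∞) {r : ℝ} (hr : 0 < r)
    (g : (Fin n → ℝ) → ℝ) :
    ENNReal.ofReal (r ^ ((n : ℝ) * (1 / α').toReal - invSum n p')) *
        discNormR n p' s' r (dil n α' r g) = discNorm n p' s' g := by
  have := h.norm_unscale α' hr (dil n α' r g) 1
  rw [undil hr g] at this
  rw [this]; simp

theorem Cfg.L0 (h : Cfg n p s p' s') {α' : ℝ≥0∞} {r : ℝ} (hr : 0 < r)
    {b : (Fin n → ℝ) → ℝ} (hb : LocallyIntegrable b volume) {c : ℝ} (hc : 0 < c)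
    (hN : ENNReal.ofReal (r ^ ((n : ℝ) * (1 / α').toReal - invSum n p')) *
        discNormR n p' s' r b ≤ ENNReal.ofReal c) :
    memH n p' s' α' b ∧ hNorm n p' s' α' b ≤ ENNReal.ofReal c := by
  set f1 : (Fin n → ℝ) → ℝ := fun x => (c⁻¹ * r ^ ((n : ℝ) * (1 / α').toReal)) * b (r • x) with hf1
  have hd : ∀ x, c * dil n α' r f1 x = b x := by
    intro x
    simp only [hf1, dil]
    rw [smul_smul, mul_inv_cancel₀ hr.ne', one_smul]
    have : r ^ (-((n : ℝ) * (1 / α').toReal)) * r ^ ((n : ℝ) * (1 / α').toReal) = 1 := by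
      rw [← Real.rpow_add hr]; simp
    calc _ = (c * c⁻¹) * (r ^ (-((n : ℝ) * (1 / α').toReal)) * r ^ ((n : ℝ) * (1 / α').toReal)) * b x := by
          ring
      _ = b x := by rw [this, mul_inv_cancel₀ hc.ne']; ring
  have hts : HasSum (fun j : ℕ => |if j = 0 then c else 0|) c := by
    have := hasSum_ite_eq (0 : ℕ) c
    refine this.congr_fun ?_ |> fun h => h
    intro j; by_cases hj : j = 0 <;> simp [hj, abs_of_pos hc]
  have BD : BlockDecomp n p' s' α' b (fun j => if j = 0 then c else 0) (fun _ => r) (fun _ => f1) := by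
    refine ⟨hts.summable, fun _ => hr, fun _ => ?_, fun _ => ?_, fun K _ => ?_⟩
    · exact (locInt_scale hb hr.ne').smul (c⁻¹ * r ^ ((n : ℝ) * (1 / α').toReal))
    · rw [hf1, h.norm_unscale α' hr, abs_of_pos (inv_pos.2 hc)]
      calc _ ≤ ENNReal.ofReal c⁻¹ * ENNReal.ofReal c := by gcongr
        _ = 1 := by rw [← ENNReal.ofReal_mul (inv_pos.2 hc).le, inv_mul_cancel₀ hc.ne']; simp
    · refine tendsto_const_nhds.congr' ?_
      filter_upwards [eventually_ge_atTop 1] with J hJ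
      have hs1 : ∀ x, ∑ j ∈ Finset.range J, (if j = 0 then c else 0) * dil n α' r f1 x = b x := by
        intro x
        rw [Finset.sum_eq_single 0]
        · simp [hd]
        · intro j _ hj; simp [hj]
        · intro h0; simp at h0; omega
      simp only [hs1, sub_self, nnnorm_zero, ENNReal.coe_zero, lintegral_zero]
  refine ⟨⟨hb, _, _, _, BD⟩, ?_⟩
  unfold hNorm
  refine (iInf_le_of_le _ <| iInf_le_of_le _ <| iInf_le_of_le _ <| iInf_le_of_le BD ?_)
  rw [hts.tsum_eq]

theorem Cfg.L1 (h : Cfg n p s p' s') (α' : ℝ≥0∞) {r : ℝ} (hr : 0 < r)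
    {b : (Fin n → ℝ) → ℝ} (hb : LocallyIntegrable b volume) (hfin : discNormR n p' s' r b < ∞) :
    memH n p' s' α' b ∧ hNorm n p' s' α' b ≤
      ENNReal.ofReal (r ^ ((n : ℝ) * (1 / α').toReal - invSum n p')) * discNormR n p' s' r b := by
  set X := ENNReal.ofReal (r ^ ((n : ℝ) * (1 / α').toReal - invSum n p')) *
        discNormR n p' s' r b with hX
  have hXf : X < ∞ := ENNReal.mul_lt_top ENNReal.ofReal_lt_top hfin
  have key : ∀ ε : ℝ, 0 < ε → memH n p' s' α' b ∧ hNorm n p' s' α' b ≤ X + ENNReal.ofReal ε := by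
    intro ε hε
    have hc : 0 < X.toReal + ε := by positivity
    have : ENNReal.ofReal (X.toReal + ε) = X + ENNReal.ofReal ε := by
      rw [ENNReal.ofReal_add ENNReal.toReal_nonneg hε.le, ENNReal.ofReal_toReal hXf.ne]
    have := h.L0 hr hb hc (α' := α') (by rw [this]; exact le_self_add)
    rwa [‹ENNReal.ofReal (X.toReal + ε) = _›] at this
  refine ⟨(key 1 one_pos).1, ?_⟩
  refine ENNReal.le_of_forall_pos_le_add fun ε hε _ => ?_
  have := (key ε hε).2
  rwa [ENNReal.ofReal_coe_nnreal] at this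

theorem Cfg.block_bound (h : Cfg n p s p' s') {α α' : ℝ≥0∞} (hα : 1 / α + 1 / α' = 1) {r : ℝ}
    (hr : 0 < r) {G g : (Fin n → ℝ) → ℝ} (hG : AEMeasurable G volume)
    (hg : LocallyIntegrable g volume) (hg1 : discNorm n p' s' g ≤ 1) :
    ∫⁻ x, ‖dil n α' r g x‖ₑ * ‖G x‖ₑ ≤ discNormA n p s α G := by
  have h1 := h.dil_normR α' hr g
  have hE := h.exp_neg hα
  set e := (n : ℝ) * (1 / α).toReal - invSum n p with he
  rw [hE] at h1
  have h2 : discNormR n p' s' r (dil n α' r g) ≤ ENNReal.ofReal (r ^ e) := by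
    calc discNormR n p' s' r (dil n α' r g)
        = ENNReal.ofReal (r ^ e) * (ENNReal.ofReal (r ^ (-e)) * discNormR n p' s' r (dil n α' r g)) := by
          rw [← mul_assoc, ← ENNReal.ofReal_mul (by positivity), ← Real.rpow_add hr]; simp
      _ ≤ ENNReal.ofReal (r ^ e) * 1 := by rw [h1]; gcongr
      _ = _ := mul_one _
  calc _ ≤ discNormR n p s r G * discNormR n p' s' r (dil n α' r g) :=
        h.holder hr hG (locInt_dil hg hr α').aestronglyMeasurable.aemeasurable
    _ ≤ discNormR n p s r G * ENNReal.ofReal (r ^ e) := by gcongr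
    _ = ENNReal.ofReal (r ^ e) * discNormR n p s r G := mul_comm _ _
    _ ≤ _ := by
      unfold discNormA
      exact le_iSup₂_of_le r hr le_rfl

end

section
variable {n : ℕ} {p s p' s' : Fin n → ℝ≥0∞}

theorem tail_bound_meas {α' : ℝ≥0∞} {f : (Fin n → ℝ) → ℝ} {c rr : ℕ → ℝ}
    {g : ℕ → (Fin n → ℝ) → ℝ} (hf : LocallyIntegrable f volume)
    (BD : BlockDecomp n p' s' α' f c rr g) {G : (Fin n → ℝ) → ℝ} (hG : Measurable G)
    {A : ℝ≥0∞} (hA : ∀ j, ∫⁻ x, ‖dil n α' (rr j) (g j) x‖ₑ * ‖G x‖ₑ ≤ A) (J : ℕ) :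
    ∫⁻ x, ‖f x - ∑ j ∈ Finset.range J, c j * dil n α' (rr j) (g j) x‖ₑ * ‖G x‖ₑ ≤
      ENNReal.ofReal (∑' j, |c (j + J)|) * A := by
  set b : ℕ → (Fin n → ℝ) → ℝ := fun j => dil n α' (rr j) (g j) with hb
  have hbm : ∀ j, AEMeasurable (b j) volume := fun j =>
    (locInt_dil (BD.gloc j) (BD.rpos j) α').aestronglyMeasurable.aemeasurable
  have hfm : AEMeasurable f volume := hf.aestronglyMeasurable.aemeasurable
  have hSm : ∀ J, AEMeasurable (fun x => ∑ j ∈ Finset.range J, c j * b j x) volume := by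
    intro J
    exact Finset.aemeasurable_fun_sum _ fun j _ => (hbm j).const_mul _
  have hsum : Summable fun j => |c (j + J)| := (summable_nat_add_iff J).2 BD.csummable
  have core : ∀ (N : ℕ) (E : Set (Fin n → ℝ)), MeasurableSet E → E ⊆ Metric.closedBall 0 N →
      (∀ x ∈ E, ‖G x‖ₑ ≤ N) →
      ∫⁻ x in E, ‖f x - ∑ j ∈ Finset.range J, c j * b j x‖ₑ * ‖G x‖ₑ ≤
        ENNReal.ofReal (∑' j, |c (j + J)|) * A := by
    intro N E hE hEN hEG
    have hconv := BD.conv (Metric.closedBall 0 N) (isCompact_closedBall _ _)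
    have hconv' : Tendsto (fun m : ℕ => (N : ℝ≥0∞) * (∫⁻ x in Metric.closedBall 0 (N : ℝ),
        ‖f x - ∑ j ∈ Finset.range (m + J), c j * b j x‖ₑ) + ENNReal.ofReal (∑' j, |c (j + J)|) * A)
        atTop (𝓝 ((N : ℝ≥0∞) * 0 + ENNReal.ofReal (∑' j, |c (j + J)|) * A)) := by
      refine Tendsto.add_const _ (ENNReal.Tendsto.const_mul ?_ (Or.inr (by simp)))
      exact (tendsto_add_atTop_iff_nat J).2 hconv
    rw [mul_zero, zero_add] at hconv'
    refine ge_of_tendsto' hconv' fun m => ?_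
    have hpt : ∀ x, ‖f x - ∑ j ∈ Finset.range J, c j * b j x‖ₑ * ‖G x‖ₑ ≤
        ‖f x - ∑ j ∈ Finset.range (m + J), c j * b j x‖ₑ * ‖G x‖ₑ +
          ∑ i ∈ Finset.range m, ENNReal.ofReal |c (i + J)| * (‖b (i + J) x‖ₑ * ‖G x‖ₑ) := by
      intro x
      have h1 : f x - ∑ j ∈ Finset.range J, c j * b j x =
          (f x - ∑ j ∈ Finset.range (m + J), c j * b j x) +
            ∑ i ∈ Finset.range m, c (i + J) * b (i + J) x := by
        rw [add_comm m J, Finset.sum_range_add]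
        simp only [add_comm J]; ring
      have h2 : ‖∑ i ∈ Finset.range m, c (i + J) * b (i + J) x‖ₑ ≤
          ∑ i ∈ Finset.range m, ENNReal.ofReal |c (i + J)| * ‖b (i + J) x‖ₑ := by
        refine (enorm_sum_le _ _).trans (le_of_eq (Finset.sum_congr rfl fun i _ => ?_))
        rw [enorm_mul, Real.enorm_eq_ofReal_abs (c (i + J))]
      calc _ ≤ (‖f x - ∑ j ∈ Finset.range (m + J), c j * b j x‖ₑ +
            ∑ i ∈ Finset.range m, ENNReal.ofReal |c (i + J)| * ‖b (i + J) x‖ₑ) * ‖G x‖ₑ := by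
            rw [h1]
            gcongr
            exact (enorm_add_le _ _).trans (by gcongr)
        _ = _ := by
            rw [add_mul, Finset.sum_mul]
            simp only [mul_assoc]
    calc _ ≤ ∫⁻ x in E, (‖f x - ∑ j ∈ Finset.range (m + J), c j * b j x‖ₑ * ‖G x‖ₑ +
          ∑ i ∈ Finset.range m, ENNReal.ofReal |c (i + J)| * (‖b (i + J) x‖ₑ * ‖G x‖ₑ)) :=
          lintegral_mono hpt
      _ = (∫⁻ x in E, ‖f x - ∑ j ∈ Finset.range (m + J), c j * b j x‖ₑ * ‖G x‖ₑ) +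
          ∑ i ∈ Finset.range m, ENNReal.ofReal |c (i + J)| * ∫⁻ x in E, ‖b (i + J) x‖ₑ * ‖G x‖ₑ := by
          have hm0 : AEMeasurable (fun x => ‖f x - ∑ j ∈ Finset.range (m + J), c j * b j x‖ₑ * ‖G x‖ₑ)
              (volume.restrict E) :=
            ((hfm.sub (hSm _)).enorm.mul hG.enorm.aemeasurable).restrict
          rw [lintegral_add_left' hm0, lintegral_finsetSum']
          · congr 1
            refine Finset.sum_congr rfl fun i _ => ?_
            rw [lintegral_const_mul' _ _ ENNReal.ofReal_ne_top]
          · intro i _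
            exact (((hbm _).enorm.mul hG.enorm.aemeasurable).restrict).const_mul _
      _ ≤ _ := by
          gcongr
          · calc _ ≤ ∫⁻ x in E, (N : ℝ≥0∞) * ‖f x - ∑ j ∈ Finset.range (m + J), c j * b j x‖ₑ := by
                  refine setLIntegral_mono' hE fun x hx => ?_
                  rw [mul_comm]; gcongr; exact hEG x hx
              _ = (N : ℝ≥0∞) * ∫⁻ x in E, ‖f x - ∑ j ∈ Finset.range (m + J), c j * b j x‖ₑ := by
                  rw [lintegral_const_mul' _ _ (by simp)]
              _ ≤ _ := by
                  gcongr
          · calc _ ≤ ∑ i ∈ Finset.range m, ENNReal.ofReal |c (i + J)| * A := by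
                  gcongr with i hi
                  exact (setLIntegral_le_lintegral _ _).trans (hA _)
              _ = ENNReal.ofReal (∑ i ∈ Finset.range m, |c (i + J)|) * A := by
                  rw [← Finset.sum_mul, ENNReal.ofReal_sum_of_nonneg fun i _ => abs_nonneg _]
              _ ≤ _ := by
                  gcongr
                  exact hsum.sum_le_tsum _ fun i _ => abs_nonneg _
  set E : ℕ → Set (Fin n → ℝ) := fun N => Metric.closedBall 0 N ∩ {x | ‖G x‖ₑ ≤ N} with hE
  have hEm : ∀ N, MeasurableSet (E N) := fun N =>
    Metric.isClosed_closedBall.measurableSet.inter (measurableSet_le hG.enorm measurable_const)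
  have hmono : Monotone E := by
    intro N M hNM
    refine inter_subset_inter (Metric.closedBall_subset_closedBall (by exact_mod_cast hNM)) ?_
    intro x hx
    exact le_trans (b := (N : ℝ≥0∞)) hx (by exact_mod_cast hNM)
  have hU : ⋃ N, E N = univ := by
    refine eq_univ_of_forall fun x => ?_
    obtain ⟨N1, h1⟩ := exists_nat_ge ‖x‖
    obtain ⟨N2, h2⟩ := exists_nat_ge ‖G x‖
    refine mem_iUnion.2 ⟨max N1 N2, ?_, ?_⟩
    · simp only [Metric.mem_closedBall, dist_zero_right]
      exact h1.trans (by exact_mod_cast le_max_left _ _)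
    · have : ‖G x‖ₑ ≤ N2 := by
        rw [← ofReal_norm]
        exact ENNReal.ofReal_le_of_le_toReal (by simpa using h2)
      exact this.trans (by exact_mod_cast le_max_right _ _)
  rw [← setLIntegral_univ, ← hU, setLIntegral_iUnion_of_directed _ hmono.directed_le]
  exact iSup_le fun N => core N (E N) (hEm N) inter_subset_left fun x hx => hx.2

theorem tail_bound {α' : ℝ≥0∞} {f : (Fin n → ℝ) → ℝ} {c rr : ℕ → ℝ}
    {g : ℕ → (Fin n → ℝ) → ℝ} (hf : LocallyIntegrable f volume)
    (BD : BlockDecomp n p' s' α' f c rr g) {G : (Fin n → ℝ) → ℝ} (hG : AEMeasurable G volume)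
    {A : ℝ≥0∞} (hA : ∀ j, ∫⁻ x, ‖dil n α' (rr j) (g j) x‖ₑ * ‖G x‖ₑ ≤ A) (J : ℕ) :
    ∫⁻ x, ‖f x - ∑ j ∈ Finset.range J, c j * dil n α' (rr j) (g j) x‖ₑ * ‖G x‖ₑ ≤
      ENNReal.ofReal (∑' j, |c (j + J)|) * A := by
  have h0 : ∀ u : (Fin n → ℝ) → ℝ≥0∞, ∫⁻ x, u x * ‖G x‖ₑ = ∫⁻ x, u x * ‖hG.mk G x‖ₑ := by
    intro u
    refine lintegral_congr_ae (hG.ae_eq_mk.mono fun x hx => ?_)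
    simp only [hx]
  rw [h0]
  refine tail_bound_meas hf BD hG.measurable_mk (fun j => ?_) J
  rw [← h0]; exact hA j

theorem Cfg.pair_bound (h : Cfg n p s p' s') {α α' : ℝ≥0∞} (hα : 1 / α + 1 / α' = 1)
    {f : (Fin n → ℝ) → ℝ} {c rr : ℕ → ℝ}
    {g : ℕ → (Fin n → ℝ) → ℝ} (hf : LocallyIntegrable f volume)
    (BD : BlockDecomp n p' s' α' f c rr g) {G : (Fin n → ℝ) → ℝ} (hG : AEMeasurable G volume) :
    ∫⁻ x, ‖f x * G x‖ₑ ≤ ENNReal.ofReal (∑' j, |c j|) * discNormA n p s α G := by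
  have := tail_bound hf BD hG (fun j => h.block_bound hα (BD.rpos j) hG (BD.gloc j) (BD.gnorm j)) 0
  simpa [enorm_mul] using this

theorem Cfg.part1 (h : Cfg n p s p' s') {α α' : ℝ≥0∞} (hα : 1 / α + 1 / α' = 1)
    {G : (Fin n → ℝ) → ℝ} (hG : memDA n p s α G) {f : (Fin n → ℝ) → ℝ}
    (hf : memH n p' s' α' f) : Integrable (fun x => f x * G x) volume := by
  obtain ⟨hfl, c, rr, g, BD⟩ := hf
  refine ⟨hfl.aestronglyMeasurable.mul hG.1.aestronglyMeasurable, ?_⟩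
  refine (h.pair_bound hα hfl BD hG.1.aestronglyMeasurable.aemeasurable).trans_lt ?_
  exact ENNReal.mul_lt_top ENNReal.ofReal_lt_top hG.2

theorem Cfg.part2_le (h : Cfg n p s p' s') {α α' : ℝ≥0∞} (hα : 1 / α + 1 / α' = 1)
    {G : (Fin n → ℝ) → ℝ} (hG : memDA n p s α G) {f : (Fin n → ℝ) → ℝ}
    (hf : memH n p' s' α' f) (hf1 : hNorm n p' s' α' f ≤ 1) :
    ENNReal.ofReal |∫ x, f x * G x| ≤ discNormA n p s α G := by
  have h1 : ENNReal.ofReal |∫ x, f x * G x| ≤ ∫⁻ x, ‖f x * G x‖ₑ := by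
    rw [← Real.enorm_eq_ofReal_abs]; exact enorm_integral_le_lintegral_enorm _
  refine h1.trans ?_
  have key : ∀ a : ℝ≥0∞, 1 < a → ∫⁻ x, ‖f x * G x‖ₑ ≤ a * discNormA n p s α G := by
    intro a ha
    have h2 := hf1.trans_lt ha
    unfold hNorm at h2
    simp only [iInf_lt_iff] at h2
    obtain ⟨c, rr, g, BD, hlt⟩ := h2
    refine (h.pair_bound hα hf.1 BD hG.1.aestronglyMeasurable.aemeasurable).trans ?_
    gcongr
  by_cases hD : discNormA n p s α G = 0
  · have := key 2 (by norm_num)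
    rw [hD] at this ⊢; simpa using this
  · have : (∫⁻ x, ‖f x * G x‖ₑ) / discNormA n p s α G ≤ 1 := by
      refine le_of_forall_gt_imp_ge_of_dense fun a ha => ?_
      exact ENNReal.div_le_of_le_mul (key a ha)
    rw [ENNReal.div_le_iff_le_mul (Or.inl hD) (Or.inl hG.2.ne), one_mul] at this
    exact this
end

section
variable {n : ℕ} {p s p' s' : Fin n → ℝ≥0∞}

theorem Cfg.charN (h : Cfg n p s p' s') {r : ℝ} (hr : 0 < r) {w g : (Fin n → ℝ) → ℝ}
    (hw : Measurable w) (hw0 : ∀ x, 0 < w x) (hg : AEMeasurable g volume)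
    (hwg : Integrable (fun x => w x * g x) volume) {M : ℝ≥0∞}
    (hyp : ∀ b : (Fin n → ℝ) → ℝ, Measurable b → (∃ m : ℕ, ∀ x, |b x| ≤ m * w x) →
      discNormR n p' s' r b ≤ 1 → ENNReal.ofReal |∫ x, b x * g x| ≤ M) :
    discNormR n p s r g ≤ M := by
  obtain ⟨u, hum, hu1, hle⟩ := h.conv hr hg
  refine hle.trans (iSup_le fun j => ?_)
  set v : ℕ → (Fin n → ℝ) → ℝ≥0∞ := fun m x => min (u j x) (ENNReal.ofReal (m * w x)) with hv
  have hvm : ∀ m, Measurable (v m) := fun m =>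
    (hum j).min ((hw.const_mul _).ennreal_ofReal)
  have hvmono : ∀ x, Monotone fun m => v m x := by
    intro x m m' hmm
    have : (m : ℝ) ≤ m' := by exact_mod_cast hmm
    exact min_le_min le_rfl (ENNReal.ofReal_le_ofReal (mul_le_mul_of_nonneg_right this (hw0 x).le))
  have hvfin : ∀ m x, v m x ≠ ∞ := fun m x =>
    ((min_le_right _ _).trans_lt ENNReal.ofReal_lt_top).ne
  have hvsup : ∀ x, ⨆ m, v m x = u j x := by
    intro x
    have ht : Tendsto (fun m : ℕ => ENNReal.ofReal (m * w x)) atTop (𝓝 ∞) :=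
      ENNReal.tendsto_ofReal_nhds_top.2
        (tendsto_natCast_atTop_atTop.atTop_mul_const (hw0 x))
    have h1 : Tendsto (fun m => v m x) atTop (𝓝 (min (u j x) ∞)) :=
      tendsto_const_nhds.min ht
    rw [min_eq_left le_top] at h1
    exact tendsto_nhds_unique (tendsto_atTop_iSup (hvmono x)) h1
  have hI : ∫⁻ x, u j x * ‖g x‖ₑ = ⨆ m, ∫⁻ x, v m x * ‖g x‖ₑ := by
    rw [← lintegral_iSup']
    · refine lintegral_congr fun x => ?_
      rw [← hvsup x, ENNReal.iSup_mul]
    · intro m; exact (hvm m).aemeasurable.mul hg.enorm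
    · exact Eventually.of_forall fun x m m' hmm => mul_le_mul_left (hvmono x hmm) _
  rw [hI]
  refine iSup_le fun m => ?_
  set g' := hg.mk g with hg'
  set sg : (Fin n → ℝ) → ℝ := fun x => if 0 ≤ g' x then 1 else -1 with hsg
  have hsgm : Measurable sg :=
    Measurable.ite (measurableSet_le measurable_const hg.measurable_mk) measurable_const measurable_const
  have hsg1 : ∀ x, |sg x| = 1 := by
    intro x; simp only [hsg]; split_ifs <;> simp
  have hsgg : ∀ x, sg x * g' x = |g' x| := by
    intro x; simp only [hsg]; split_ifs with h0
    · rw [abs_of_nonneg h0, one_mul]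
    · rw [abs_of_neg (not_le.1 h0)]; ring
  set b : (Fin n → ℝ) → ℝ := fun x => (v m x).toReal * sg x with hb
  have hbm : Measurable b := (hvm m).ennreal_toReal.mul hsgm
  have habs : ∀ x, |b x| = (v m x).toReal := by
    intro x; simp only [hb]; rw [abs_mul, hsg1, mul_one, abs_of_nonneg ENNReal.toReal_nonneg]
  have hbw : ∀ x, |b x| ≤ m * w x := by
    intro x
    rw [habs]
    exact ENNReal.toReal_le_of_le_ofReal (mul_nonneg (by positivity) (hw0 x).le) (min_le_right _ _)
  have hbN : discNormR n p' s' r b ≤ 1 := by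
    refine le_trans ?_ (hu1 j)
    rw [discNormR_eq]
    refine h.good.mono' _ _ (emb_mono n r fun x => ?_)
    rw [Real.enorm_eq_ofReal_abs, habs, ENNReal.ofReal_toReal (hvfin m x)]
    exact min_le_left _ _
  have h1 := hyp b hbm ⟨m, hbw⟩ hbN
  have h2 : (fun x => b x * g x) =ᵐ[volume] fun x => (v m x).toReal * |g x| := by
    filter_upwards [hg.ae_eq_mk] with x hx
    simp only [hb]
    rw [hx, mul_assoc, hsgg]
  have h3 : Integrable (fun x => (v m x).toReal * |g x|) volume := by
    refine (hwg.const_mul (m : ℝ)).mono ?_ (Eventually.of_forall fun x => ?_)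
    · exact (((hvm m).ennreal_toReal.aemeasurable).mul hg.abs).aestronglyMeasurable
    · have hx := hbw x
      rw [habs] at hx
      rw [Real.norm_eq_abs, Real.norm_eq_abs, ← mul_assoc, abs_mul, abs_abs, abs_mul,
        abs_of_nonneg ENNReal.toReal_nonneg, abs_of_nonneg (mul_nonneg (by positivity) (hw0 x).le)]
      gcongr
  have h4 : ∫⁻ x, v m x * ‖g x‖ₑ = ENNReal.ofReal (∫ x, b x * g x) := by
    rw [integral_congr_ae h2, ofReal_integral_eq_lintegral_ofReal h3
      (Eventually.of_forall fun x => mul_nonneg ENNReal.toReal_nonneg (abs_nonneg _))]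
    refine lintegral_congr fun x => ?_
    rw [ENNReal.ofReal_mul ENNReal.toReal_nonneg, ENNReal.ofReal_toReal (hvfin m x),
      Real.enorm_eq_ofReal_abs]
  rw [h4]
  exact (ENNReal.ofReal_le_ofReal (le_abs_self _)).trans h1

theorem locInt_bdd {n : ℕ} {b : (Fin n → ℝ) → ℝ} (hb : AEStronglyMeasurable b volume) (m : ℝ)
    (hm : ∀ x, |b x| ≤ m) : LocallyIntegrable b volume := by
  refine (locallyIntegrable_const m).mono hb (Eventually.of_forall fun x => ?_)
  rw [Real.norm_eq_abs, Real.norm_eq_abs]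
  exact (hm x).trans (le_abs_self m)

theorem Cfg.charA (h : Cfg n p s p' s') {α α' : ℝ≥0∞} (hα : 1 / α + 1 / α' = 1)
    {w g : (Fin n → ℝ) → ℝ}
    (hw : Measurable w) (hw0 : ∀ x, 0 < w x) (hw1 : ∀ x, w x ≤ 1) (hg : AEMeasurable g volume)
    (hwg : Integrable (fun x => w x * g x) volume) {M : ℝ≥0∞}
    (hyp : ∀ b : (Fin n → ℝ) → ℝ, Measurable b → (∃ m : ℕ, ∀ x, |b x| ≤ m * w x) →
      memH n p' s' α' b → hNorm n p' s' α' b ≤ 1 → ENNReal.ofReal |∫ x, b x * g x| ≤ M) :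
    discNormA n p s α g ≤ M := by
  unfold discNormA
  refine iSup₂_le fun r hr => ?_
  have hE := h.exp_neg hα
  set e := (n : ℝ) * (1 / α).toReal - invSum n p with he
  have hre : 0 < r ^ e := Real.rpow_pos_of_pos hr _
  have hrn : 0 < r ^ (-e) := Real.rpow_pos_of_pos hr _
  have hmul : r ^ e * r ^ (-e) = 1 := by rw [← Real.rpow_add hr]; simp
  have hmulE : ENNReal.ofReal (r ^ e) * ENNReal.ofReal (r ^ (-e)) = 1 := by
    rw [← ENNReal.ofReal_mul hre.le, hmul]; simp
  suffices hs : discNormR n p s r g ≤ ENNReal.ofReal (r ^ (-e)) * M by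
    calc _ ≤ ENNReal.ofReal (r ^ e) * (ENNReal.ofReal (r ^ (-e)) * M) := by gcongr
      _ = M := by rw [← mul_assoc, hmulE, one_mul]
  refine h.charN hr hw hw0 hg hwg fun b hbm hbw hb1 => ?_
  obtain ⟨m, hm⟩ := hbw
  have hbl : LocallyIntegrable b volume := locInt_bdd hbm.aestronglyMeasurable m fun x =>
    (hm x).trans (by nlinarith [hw1 x, (Nat.cast_nonneg m : (0 : ℝ) ≤ m)])
  have hbl2 : LocallyIntegrable (fun x => r ^ e * b x) volume := hbl.smul (r ^ e)
  have hN2 := h.norm_smul' r (r ^ e) b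
  rw [abs_of_pos hre] at hN2
  have hle2 : ENNReal.ofReal (r ^ (-e)) * discNormR n p' s' r (fun x => r ^ e * b x) ≤ 1 := by
    rw [hN2, ← mul_assoc, mul_comm (ENNReal.ofReal (r ^ (-e))), hmulE, one_mul]; exact hb1
  have hL := h.L1 α' hr hbl2 (by
    rw [hN2]; exact ENNReal.mul_lt_top ENNReal.ofReal_lt_top (hb1.trans_lt (by simp)))
  rw [hE] at hL
  obtain ⟨k, hk⟩ := exists_nat_ge (r ^ e)
  have h5 := hyp (fun x => r ^ e * b x) (hbm.const_mul _) ⟨k * m, fun x => by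
    rw [abs_mul, abs_of_pos hre]; push_cast
    rw [mul_assoc]
    exact mul_le_mul hk (hm x) (abs_nonneg _) (by positivity)⟩ hL.1 (hL.2.trans hle2)
  have h6 : ∫ x, r ^ e * b x * g x = r ^ e * ∫ x, b x * g x := by
    simp only [mul_assoc]; rw [integral_const_mul]
  rw [h6, abs_mul, abs_of_pos hre, ENNReal.ofReal_mul hre.le] at h5
  calc ENNReal.ofReal |∫ x, b x * g x|
      = ENNReal.ofReal (r ^ (-e)) * (ENNReal.ofReal (r ^ e) * ENNReal.ofReal |∫ x, b x * g x|) := by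
        rw [← mul_assoc, mul_comm (ENNReal.ofReal (r ^ (-e))), hmulE, one_mul]
    _ ≤ _ := by gcongr

theorem Cfg.memH_w (h : Cfg n p s p' s') (α' : ℝ≥0∞) {w b : (Fin n → ℝ) → ℝ}
    (hw0 : ∀ x, 0 < w x) (hw1 : ∀ x, w x ≤ 1) (hwN : discNormR n p' s' 1 w < ∞)
    (hb : AEStronglyMeasurable b volume) {m : ℝ} (hm : ∀ x, |b x| ≤ m * w x) :
    discNormR n p' s' 1 b < ∞ ∧ memH n p' s' α' b ∧
      hNorm n p' s' α' b ≤ discNormR n p' s' 1 b := by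
  have hm0 : 0 ≤ m := by
    have := (abs_nonneg _).trans (hm 0)
    exact nonneg_of_mul_nonneg_left this (hw0 0)
  have h1 : discNormR n p' s' 1 b < ∞ := by
    refine (h.norm_mono' 1 (g := fun x => m * w x) fun x => (hm x).trans (le_abs_self _)).trans_lt ?_
    rw [h.norm_smul']
    exact ENNReal.mul_lt_top ENNReal.ofReal_lt_top hwN
  have hbl : LocallyIntegrable b volume := locInt_bdd hb m fun x =>
    (hm x).trans (by nlinarith [hw1 x])
  have := h.L1 α' one_pos hbl h1
  refine ⟨h1, this.1, this.2.trans (by simp)⟩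

theorem Cfg.part2 (h : Cfg n p s p' s') {α α' : ℝ≥0∞} (hα : 1 / α + 1 / α' = 1)
    {G : (Fin n → ℝ) → ℝ} (hG : memDA n p s α G) :
    (⨆ (f : (Fin n → ℝ) → ℝ)
          (_ : memH n p' s' α' f ∧ hNorm n p' s' α' f ≤ 1),
        ENNReal.ofReal |∫ x, f x * G x|) = discNormA n p s α G := by
  refine le_antisymm (iSup₂_le fun f hf => h.part2_le hα hG hf.1 hf.2) ?_
  obtain ⟨w, hwm, hw0, hw1, hwK, hwN⟩ := h.weight
  refine h.charA hα hwm hw0 hw1 hG.1.aestronglyMeasurable.aemeasurable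
    (h.part1 hα hG (h.memH_w α' hw0 hw1 hwN hwm.aestronglyMeasurable (m := 1) fun x => ?_).2.1) ?_
  · rw [abs_of_pos (hw0 x), one_mul]
  · intro b _ _ hb hb1
    exact le_iSup₂_of_le b ⟨hb, hb1⟩ le_rfl

theorem Cfg.part3 (h : Cfg n p s p' s') {α α' : ℝ≥0∞} (hα : 1 / α + 1 / α' = 1)
    {g₁ g₂ : (Fin n → ℝ) → ℝ} (h1 : memDA n p s α g₁) (h2 : memDA n p s α g₂)
    (heq : ∀ f, memH n p' s' α' f → ∫ x, f x * g₁ x = ∫ x, f x * g₂ x) :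
    g₁ =ᵐ[volume] g₂ := by
  obtain ⟨w, hwm, hw0, hw1, hwK, hwN⟩ := h.weight
  have key : ∀ᵐ x ∂(volume : Measure (Fin n → ℝ)), (g₁ - g₂) x = 0 := by
    refine ae_eq_zero_of_forall_setIntegral_isCompact_eq_zero' (h1.1.sub h2.1) fun K hK => ?_
    obtain ⟨c, hc, hcw⟩ := hwK K hK
    have hH : memH n p' s' α' (K.indicator fun _ => (1 : ℝ)) := by
      refine (h.memH_w α' hw0 hw1 hwN
        (measurable_const.indicator hK.measurableSet).aestronglyMeasurable (m := c⁻¹) fun x => ?_).2.1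
      by_cases hx : x ∈ K
      · simp only [Set.indicator_of_mem hx, abs_one]
        rw [inv_mul_eq_div, le_div_iff₀ hc, one_mul]; exact hcw x hx
      · simp only [Set.indicator_of_notMem hx, abs_zero]
        exact mul_nonneg (by positivity) (hw0 x).le
    have h3 := heq _ hH
    have h4 : ∀ g : (Fin n → ℝ) → ℝ, ∫ x, K.indicator (fun _ => (1 : ℝ)) x * g x = ∫ x in K, g x := by
      intro g
      rw [← integral_indicator hK.measurableSet]
      congr 1; funext x
      by_cases hx : x ∈ K <;> simp [hx]
    rw [h4, h4] at h3
    simp only [Pi.sub_apply]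
    rw [integral_sub (h1.1.integrableOn_isCompact hK) (h2.1.integrableOn_isCompact hK), h3, sub_self]
  filter_upwards [key] with x hx
  simpa [sub_eq_zero] using hx
end

structure BLF (n : ℕ) (p' s' : Fin n → ℝ≥0∞) (α' : ℝ≥0∞) (T : ((Fin n → ℝ) → ℝ) → ℝ)
    (M : ℝ) : Prop where
  nonneg : 0 ≤ M
  add : ∀ f g, memH n p' s' α' f → memH n p' s' α' g → T (f + g) = T f + T g
  smul : ∀ (c : ℝ) f, memH n p' s' α' f → T (c • f) = c * T f
  bd : ∀ f, memH n p' s' α' f → |T f| ≤ M * (hNorm n p' s' α' f).toReal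

section
variable {n : ℕ} {p s p' s' : Fin n → ℝ≥0∞} {α' : ℝ≥0∞} {T : ((Fin n → ℝ) → ℝ) → ℝ} {M : ℝ}

theorem BLF.bound (t : BLF n p' s' α' T M) (h : Cfg n p s p' s') {r : ℝ} (hr : 0 < r)
    {b : (Fin n → ℝ) → ℝ} (hb : LocallyIntegrable b volume) (hfin : discNormR n p' s' r b < ∞) :
    |T b| ≤ M * (ENNReal.ofReal (r ^ ((n : ℝ) * (1 / α').toReal - invSum n p')) *
      discNormR n p' s' r b).toReal := by
  have hL := h.L1 α' hr hb hfin
  refine (t.bd b hL.1).trans (mul_le_mul_of_nonneg_left ?_ t.nonneg)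
  exact ENNReal.toReal_mono (ENNReal.mul_lt_top ENNReal.ofReal_lt_top hfin).ne hL.2

theorem Cfg.norm_zero (h : Cfg n p s p' s') (r : ℝ) {b : (Fin n → ℝ) → ℝ} (hb : b =ᵐ[volume] 0) :
    discNormR n p' s' r b = 0 := by
  rw [h.norm_ae' r hb]
  have := h.norm_smul' r 0 0
  simp only [zero_mul, abs_zero, ENNReal.ofReal_zero] at this
  exact this

theorem BLF.ae_zero (t : BLF n p' s' α' T M) (h : Cfg n p s p' s')
    {b : (Fin n → ℝ) → ℝ} (hb : b =ᵐ[volume] 0) : memH n p' s' α' b ∧ T b = 0 := by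
  have hbl : LocallyIntegrable b volume :=
    ((integrable_zero _ _ _).congr hb.symm).locallyIntegrable
  have h0 := h.norm_zero 1 hb
  have hL := h.L1 α' one_pos hbl (by rw [h0]; simp)
  have hB := t.bound h one_pos hbl (by rw [h0]; simp)
  refine ⟨hL.1, ?_⟩
  rw [h0] at hB
  simpa using hB

theorem BLF.congr (t : BLF n p' s' α' T M) (h : Cfg n p s p' s')
    {f f' : (Fin n → ℝ) → ℝ} (hf : memH n p' s' α' f) (hff : f' =ᵐ[volume] f) : T f' = T f := by
  have h1 := t.ae_zero h (b := f' - f) (by filter_upwards [hff] with x hx; simp [hx])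
  have := t.add f (f' - f) hf h1.1
  rw [h1.2, add_zero, add_sub_cancel] at this
  exact this

theorem BLF.dct (t : BLF n p' s' α' T M) (h : Cfg n p s p' s') {r : ℝ} (hr : 0 < r)
    (f : ℕ → (Fin n → ℝ) → ℝ)
    (F : (Fin n → ℝ) → ℝ) (hf : ∀ j, Measurable (f j)) (hF : Measurable F)
    (hFl : LocallyIntegrable F volume)
    (hle : ∀ j x, |f j x| ≤ |F x|) (hfin : discNormR n p' s' r F < ∞)
    (hlim : ∀ x, Tendsto (fun j => f j x) atTop (𝓝 0)) :
    Tendsto (fun j => T (f j)) atTop (𝓝 0) := by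
  have h1 := h.dct hr f F hf hF hle hfin hlim
  have h2 : Tendsto (fun j => M * (ENNReal.ofReal (r ^ ((n : ℝ) * (1 / α').toReal - invSum n p')) *
      discNormR n p' s' r (f j)).toReal) atTop (𝓝 0) := by
    have h3 := ENNReal.Tendsto.const_mul (a := ENNReal.ofReal (r ^ ((n : ℝ) * (1 / α').toReal - invSum n p')))
      h1 (Or.inr ENNReal.ofReal_ne_top)
    rw [mul_zero] at h3
    have h4 := ((ENNReal.tendsto_toReal ENNReal.zero_ne_top).comp h3).const_mul M
    simpa using h4
  refine squeeze_zero_norm (fun j => ?_) h2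
  rw [Real.norm_eq_abs]
  exact t.bound h hr (hFl.mono (hf j).aestronglyMeasurable (Eventually.of_forall (hle j)))
    ((h.norm_mono' r (hle j)).trans_lt hfin)

/-- the weight package -/
structure Wt (n : ℕ) (p' s' : Fin n → ℝ≥0∞) (w : (Fin n → ℝ) → ℝ) : Prop where
  meas : Measurable w
  pos : ∀ x, 0 < w x
  le1 : ∀ x, w x ≤ 1
  cpt : ∀ K, IsCompact K → ∃ c > 0, ∀ x ∈ K, c ≤ w x
  fin : discNormR n p' s' 1 w < ∞

theorem Wt.locInt {w : (Fin n → ℝ) → ℝ} (hw : Wt n p' s' w) : LocallyIntegrable w volume :=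
  locInt_bdd hw.meas.aestronglyMeasurable 1 fun x => by rw [abs_of_pos (hw.pos x)]; exact hw.le1 x

theorem Wt.memH {w : (Fin n → ℝ) → ℝ} (hw : Wt n p' s' w) (h : Cfg n p s p' s') (α' : ℝ≥0∞)
    {φ : (Fin n → ℝ) → ℝ} (hφ : Measurable φ) {C : ℝ} (hC : ∀ x, |φ x| ≤ C) :
    memH n p' s' α' (fun x => φ x * w x) := by
  refine (h.memH_w α' hw.pos hw.le1 hw.fin (hφ.mul hw.meas).aestronglyMeasurable (m := C) fun x => ?_).2.1
  rw [Pi.mul_apply, abs_mul, abs_of_pos (hw.pos x)]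
  exact mul_le_mul_of_nonneg_right (hC x) (hw.pos x).le

theorem BLF.dctw (t : BLF n p' s' α' T M) (h : Cfg n p s p' s') {w : (Fin n → ℝ) → ℝ}
    (hw : Wt n p' s' w) (f : ℕ → (Fin n → ℝ) → ℝ) {C : ℝ}
    (hf : ∀ j, Measurable (f j)) (hC : ∀ j x, |f j x| ≤ C)
    (hlim : ∀ x, Tendsto (fun j => f j x) atTop (𝓝 0)) :
    Tendsto (fun j => T (fun x => f j x * w x)) atTop (𝓝 0) := by
  refine t.dct h one_pos _ (fun x => C * w x) (fun j => (hf j).mul hw.meas) (hw.meas.const_mul C)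
    (hw.locInt.smul C) (fun j x => ?_) ?_ (fun x => ?_)
  · rw [abs_mul, abs_mul]
    exact mul_le_mul_of_nonneg_right ((hC j x).trans (le_abs_self _)) (abs_nonneg _)
  · rw [h.norm_smul']; exact ENNReal.mul_lt_top ENNReal.ofReal_lt_top hw.fin
  · simpa using (hlim x).mul_const (w x)

def chi (E : Set (Fin n → ℝ)) : (Fin n → ℝ) → ℝ := E.indicator fun _ => 1

theorem chi_meas {E : Set (Fin n → ℝ)} (hE : MeasurableSet E) : Measurable (chi E) :=
  measurable_const.indicator hE

theorem chi_le (E : Set (Fin n → ℝ)) (x) : |chi E x| ≤ 1 := by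
  unfold chi; by_cases hx : x ∈ E <;> simp [hx]

theorem BLF.chi_add (t : BLF n p' s' α' T M) (h : Cfg n p s p' s') {w : (Fin n → ℝ) → ℝ}
    (hw : Wt n p' s' w) {E F : Set (Fin n → ℝ)} (hE : MeasurableSet E) (hF : MeasurableSet F)
    (hd : Disjoint E F) :
    T (fun x => chi (E ∪ F) x * w x) = T (fun x => chi E x * w x) + T (fun x => chi F x * w x) := by
  rw [← t.add _ _ (hw.memH h α' (chi_meas hE) (chi_le E)) (hw.memH h α' (chi_meas hF) (chi_le F))]
  congr 1
  funext x
  simp only [Pi.add_apply, ← add_mul]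
  congr 1
  unfold chi
  rw [Set.indicator_union_of_disjoint hd]

theorem BLF.chi_sum (t : BLF n p' s' α' T M) (h : Cfg n p s p' s') {w : (Fin n → ℝ) → ℝ}
    (hw : Wt n p' s' w) {E : ℕ → Set (Fin n → ℝ)} (hE : ∀ i, MeasurableSet (E i))
    (hd : Pairwise (Function.onFun Disjoint E)) (S : Finset ℕ) :
    T (fun x => chi (⋃ i ∈ S, E i) x * w x) = ∑ i ∈ S, T (fun x => chi (E i) x * w x) := by
  induction S using Finset.induction_on with
  | empty =>
    simp only [Finset.notMem_empty, iUnion_of_empty, iUnion_empty, Finset.sum_empty]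
    exact (t.ae_zero h (Eventually.of_forall fun x => by simp [chi])).2
  | insert a S ha ih =>
    rw [Finset.sum_insert ha, Finset.set_biUnion_insert, t.chi_add h hw (hE a)
      (S.measurableSet_biUnion fun i _ => hE i), ih]
    rw [Set.disjoint_iUnion₂_right]
    intro i hi
    exact hd (fun hai => ha (hai ▸ hi))

open Classical in
def sm (t : BLF n p' s' α' T M) (h : Cfg n p s p' s') {w : (Fin n → ℝ) → ℝ}
    (hw : Wt n p' s' w) : SignedMeasure (Fin n → ℝ) where
  measureOf' E := if MeasurableSet E then T (fun x => chi E x * w x) else 0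
  empty' := by
    simp only [MeasurableSet.empty, if_true]
    exact (t.ae_zero h (Eventually.of_forall fun x => by simp [chi])).2
  not_measurable' E hE := by simp [hE]
  m_iUnion' E hE hd := by
    simp only [hE, MeasurableSet.iUnion hE, if_true]
    unfold HasSum
    simp only [SummationFilter.unconditional_filter]
    refine tendsto_of_seq_tendsto fun F hF => ?_
    have hEF : ∀ k, MeasurableSet (⋃ i ∈ F k, E i) := fun k =>
      (F k).measurableSet_biUnion fun i _ => hE i
    have hsub : ∀ k, (⋃ i ∈ F k, E i) ⊆ ⋃ i, E i := fun k => iUnion₂_subset fun i _ => subset_iUnion E i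
    have h1 : ∀ k, ∑ i ∈ F k, T (fun x => chi (E i) x * w x) = T (fun x => chi (⋃ i, E i) x * w x) -
        T (fun x => chi ((⋃ i, E i) \ ⋃ i ∈ F k, E i) x * w x) := by
      intro k
      rw [← t.chi_sum h hw hE hd, eq_sub_iff_add_eq, ← t.chi_add h hw (hEF k)
        ((MeasurableSet.iUnion hE).diff (hEF k)) disjoint_sdiff_right, Set.union_sdiff_cancel (hsub k)]
    simp only [Function.comp_def, h1]
    have h2 := t.dctw h hw (fun k => chi ((⋃ i, E i) \ ⋃ i ∈ F k, E i)) (C := 1)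
      (fun k => chi_meas ((MeasurableSet.iUnion hE).diff (hEF k))) (fun k x => chi_le _ x) (by
        intro x
        refine tendsto_const_nhds.congr' ?_
        by_cases hx : x ∈ ⋃ i, E i
        · obtain ⟨i, hi⟩ := mem_iUnion.1 hx
          have := hF.eventually (eventually_ge_atTop {i})
          filter_upwards [this] with k hk
          have hik : i ∈ F k := hk (Finset.mem_singleton_self i)
          symm
          unfold chi
          refine Set.indicator_of_notMem (fun hh => hh.2 ?_) _
          exact mem_iUnion₂.2 ⟨i, hik, hi⟩
        · refine Eventually.of_forall fun k => ?_
          symm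
          unfold chi
          exact Set.indicator_of_notMem (fun hh => hx hh.1) _)
    simpa using h2.const_sub (T (fun x => chi (⋃ i, E i) x * w x))

theorem sm_apply (t : BLF n p' s' α' T M) (h : Cfg n p s p' s') {w : (Fin n → ℝ) → ℝ}
    (hw : Wt n p' s' w) {E : Set (Fin n → ℝ)} (hE : MeasurableSet E) :
    sm t h hw E = T (fun x => chi E x * w x) := by
  exact if_pos hE

theorem BLF.density (t : BLF n p' s' α' T M) (h : Cfg n p s p' s') {w : (Fin n → ℝ) → ℝ}
    (hw : Wt n p' s' w) : ∃ g0 : (Fin n → ℝ) → ℝ, Measurable g0 ∧ Integrable g0 volume ∧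
      ∀ E, MeasurableSet E → T (fun x => chi E x * w x) = ∫ x, chi E x * g0 x := by
  have hac : sm t h hw ≪ᵥ (volume : Measure (Fin n → ℝ)).toENNRealVectorMeasure := by
    refine VectorMeasure.AbsolutelyContinuous.mk fun E hE h0 => ?_
    rw [Measure.toENNRealVectorMeasure_apply_measurable hE] at h0
    rw [sm_apply t h hw hE]
    refine (t.ae_zero h ?_).2
    have : ∀ᵐ x ∂(volume : Measure (Fin n → ℝ)), x ∉ E := measure_eq_zero_iff_ae_notMem.1 h0
    filter_upwards [this] with x hx
    simp [chi, hx]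
  refine ⟨(sm t h hw).rnDeriv volume, SignedMeasure.measurable_rnDeriv _ _,
    SignedMeasure.integrable_rnDeriv _ _, fun E hE => ?_⟩
  rw [← sm_apply t h hw hE]
  conv_lhs => rw [← SignedMeasure.withDensityᵥ_rnDeriv_eq _ volume hac]
  rw [withDensityᵥ_apply (SignedMeasure.integrable_rnDeriv _ _) hE, ← integral_indicator hE]
  congr 1; funext x
  by_cases hx : x ∈ E <;> simp [hx, chi]

theorem BLF.density_bdd (t : BLF n p' s' α' T M) (h : Cfg n p s p' s') {w : (Fin n → ℝ) → ℝ}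
    (hw : Wt n p' s' w) {g0 : (Fin n → ℝ) → ℝ} (hg0 : Integrable g0 volume)
    (hE : ∀ E, MeasurableSet E → T (fun x => chi E x * w x) = ∫ x, chi E x * g0 x)
    {φ : (Fin n → ℝ) → ℝ} (hφ : Measurable φ) {C : ℝ} (hC : ∀ x, |φ x| ≤ C) :
    T (fun x => φ x * w x) = ∫ x, φ x * g0 x := by
  have hsb : ∀ ψ : SimpleFunc (Fin n → ℝ) ℝ, ∃ C, ∀ x, |ψ x| ≤ C := fun ψ => ψ.exists_forall_norm_le
  have hint : ∀ {ψ : (Fin n → ℝ) → ℝ} {C : ℝ}, Measurable ψ → (∀ x, |ψ x| ≤ C) →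
      Integrable (fun x => ψ x * g0 x) volume := by
    intro ψ C hψ hC
    exact hg0.bdd_mul hψ.aestronglyMeasurable (Eventually.of_forall hC)
  have hsimp : ∀ ψ : SimpleFunc (Fin n → ℝ) ℝ, T (fun x => ψ x * w x) = ∫ x, ψ x * g0 x := by
    intro ψ
    induction ψ using SimpleFunc.induction with
    | const c hs =>
      rename_i S
      have e1 : (fun x => (SimpleFunc.piecewise S hs (SimpleFunc.const _ c) (SimpleFunc.const _ 0)) x * w x)
          = c • fun x => chi S x * w x := by
        funext x
        by_cases hx : x ∈ S <;> simp [hx, chi]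
      have e2 : (fun x => (SimpleFunc.piecewise S hs (SimpleFunc.const _ c) (SimpleFunc.const _ 0)) x * g0 x)
          = fun x => c * (chi S x * g0 x) := by
        funext x
        by_cases hx : x ∈ S <;> simp [hx, chi]
      rw [e1, e2, integral_const_mul, t.smul _ _ (hw.memH h α' (chi_meas hs) (chi_le S)), hE S hs]
    | add hdis h1 h2 =>
      rename_i ψ₁ ψ₂
      obtain ⟨C1, hC1⟩ := hsb ψ₁
      obtain ⟨C2, hC2⟩ := hsb ψ₂
      have e1 : (fun x => (ψ₁ + ψ₂) x * w x) = (fun x => ψ₁ x * w x) + fun x => ψ₂ x * w x := by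
        funext x; simp [add_mul]
      have e2 : (fun x => (ψ₁ + ψ₂) x * g0 x) = fun x => ψ₁ x * g0 x + ψ₂ x * g0 x := by
        funext x; simp [add_mul]
      rw [e1, e2, t.add _ _ (hw.memH h α' ψ₁.measurable hC1) (hw.memH h α' ψ₂.measurable hC2),
        integral_add (hint ψ₁.measurable hC1) (hint ψ₂.measurable hC2), h1, h2]
  have hsm := hφ.stronglyMeasurable
  have hC0 : 0 ≤ C := (abs_nonneg _).trans (hC 0)
  set ψ := hsm.approxBounded C with hψ
  have hlim : ∀ x, Tendsto (fun j => ψ j x) atTop (𝓝 (φ x)) := fun x =>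
    hsm.tendsto_approxBounded_of_norm_le (hC x)
  have hψb : ∀ j x, |ψ j x| ≤ C := fun j x => hsm.norm_approxBounded_le hC0 j x
  have l1 : Tendsto (fun j => T (fun x => ψ j x * w x)) atTop (𝓝 (T (fun x => φ x * w x))) := by
    have h1 := t.dctw h hw (fun j x => φ x - ψ j x) (C := C + C)
      (fun j => hφ.sub (ψ j).measurable)
      (fun j x => (abs_sub _ _).trans (add_le_add (hC x) (hψb j x)))
      (fun x => by simpa using (hlim x).const_sub (φ x))
    have h2 : ∀ j, T (fun x => ψ j x * w x) = T (fun x => φ x * w x) - T (fun x => (φ x - ψ j x) * w x) := by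
      intro j
      rw [eq_sub_iff_add_eq, ← t.add _ _ (hw.memH h α' (ψ j).measurable (hψb j))
        (hw.memH h α' (φ := fun x => φ x - ψ j x) (hφ.sub (ψ j).measurable)
          (fun x => (abs_sub _ _).trans (add_le_add (hC x) (hψb j x))))]
      congr 1; funext x; simp only [Pi.add_apply]; ring
    simp only [h2]
    simpa using h1.const_sub (T (fun x => φ x * w x))
  have l2 : Tendsto (fun j => ∫ x, ψ j x * g0 x) atTop (𝓝 (∫ x, φ x * g0 x)) := by
    refine tendsto_integral_of_dominated_convergence (fun x => C * |g0 x|)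
      (fun j => (hint (ψ j).measurable (hψb j)).aestronglyMeasurable) (hg0.abs.const_mul C)
      (fun j => Eventually.of_forall fun x => ?_) (Eventually.of_forall fun x => (hlim x).mul_const _)
    rw [Real.norm_eq_abs, abs_mul]
    exact mul_le_mul_of_nonneg_right (hψb j x) (abs_nonneg _)
  simp only [hsimp] at l1
  exact tendsto_nhds_unique l1 l2
end

section
variable {n : ℕ} {p s p' s' : Fin n → ℝ≥0∞} {α' : ℝ≥0∞} {T : ((Fin n → ℝ) → ℝ) → ℝ} {M : ℝ}

theorem BlockDecomp.sum_locInt {f : (Fin n → ℝ) → ℝ} {c rr : ℕ → ℝ} {g : ℕ → (Fin n → ℝ) → ℝ}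
    (BD : BlockDecomp n p' s' α' f c rr g) (J : ℕ) :
    LocallyIntegrable (fun x => ∑ j ∈ Finset.range J, c j * dil n α' (rr j) (g j) x) volume := by
  induction J with
  | zero =>
    simp only [Finset.range_zero, Finset.sum_empty]
    exact locallyIntegrable_const 0
  | succ J ih =>
    simp only [Finset.sum_range_succ]
    exact ih.add ((locInt_dil (BD.gloc J) (BD.rpos J) α').smul (c J))

theorem BlockDecomp.partial_mem {f : (Fin n → ℝ) → ℝ} {c rr : ℕ → ℝ} {g : ℕ → (Fin n → ℝ) → ℝ}
    (BD : BlockDecomp n p' s' α' f c rr g) (J : ℕ) :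
    memH n p' s' α' (fun x => ∑ j ∈ Finset.range J, c j * dil n α' (rr j) (g j) x) := by
  refine ⟨BD.sum_locInt J, fun j => if j < J then c j else 0, rr, g, ?_, BD.rpos, BD.gloc, BD.gnorm, ?_⟩
  · refine BD.csummable.of_nonneg_of_le (fun j => abs_nonneg _) fun j => ?_
    split_ifs <;> simp
  · intro K _
    refine tendsto_const_nhds.congr' ?_
    filter_upwards [eventually_ge_atTop J] with J' hJ'
    have : ∀ x, ∑ j ∈ Finset.range J', (if j < J then c j else 0) * dil n α' (rr j) (g j) x =
        ∑ j ∈ Finset.range J, c j * dil n α' (rr j) (g j) x := by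
      intro x
      rw [← Finset.sum_subset (Finset.range_mono hJ') (fun j _ hj => ?_)]
      · refine Finset.sum_congr rfl fun j hj => ?_
        rw [if_pos (Finset.mem_range.1 hj)]
      · rw [if_neg (fun hh => hj (Finset.mem_range.2 hh)), zero_mul]
    simp only [this, sub_self, nnnorm_zero, ENNReal.coe_zero, lintegral_zero]

theorem BlockDecomp.shift {f : (Fin n → ℝ) → ℝ} {c rr : ℕ → ℝ} {g : ℕ → (Fin n → ℝ) → ℝ}
    (BD : BlockDecomp n p' s' α' f c rr g) (J : ℕ) :
    BlockDecomp n p' s' α' (fun x => f x - ∑ j ∈ Finset.range J, c j * dil n α' (rr j) (g j) x)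
      (fun j => c (j + J)) (fun j => rr (j + J)) (fun j => g (j + J)) := by
  refine ⟨(summable_nat_add_iff J).2 BD.csummable, fun j => BD.rpos _, fun j => BD.gloc _,
    fun j => BD.gnorm _, fun K hK => ?_⟩
  have := (tendsto_add_atTop_iff_nat J).2 (BD.conv K hK)
  refine this.congr fun m => ?_
  refine lintegral_congr fun x => ?_
  rw [add_comm m J, Finset.sum_range_add]
  simp only [add_comm J, sub_sub]

theorem BLF.tail (t : BLF n p' s' α' T M) {f : (Fin n → ℝ) → ℝ} (hf : LocallyIntegrable f volume)
    {c rr : ℕ → ℝ} {g : ℕ → (Fin n → ℝ) → ℝ}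
    (BD : BlockDecomp n p' s' α' f c rr g) (J : ℕ) :
    |T f - T (fun x => ∑ j ∈ Finset.range J, c j * dil n α' (rr j) (g j) x)| ≤
      M * ∑' j, |c (j + J)| := by
  have hl := hf.sub (BD.sum_locInt J)
  have hm : memH n p' s' α' (fun x => f x - ∑ j ∈ Finset.range J, c j * dil n α' (rr j) (g j) x) :=
    ⟨hl, _, _, _, BD.shift J⟩
  have h1 := t.add _ _ (BD.partial_mem J) hm
  have h2 : ((fun x => ∑ j ∈ Finset.range J, c j * dil n α' (rr j) (g j) x) +
      fun x => f x - ∑ j ∈ Finset.range J, c j * dil n α' (rr j) (g j) x) = f := by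
    funext x; simp only [Pi.add_apply]; ring
  rw [h2] at h1
  rw [h1, add_sub_cancel_left]
  refine (t.bd _ hm).trans (mul_le_mul_of_nonneg_left ?_ t.nonneg)
  refine ENNReal.toReal_le_of_le_ofReal (tsum_nonneg fun j => abs_nonneg _) ?_
  unfold hNorm
  exact iInf_le_of_le _ <| iInf_le_of_le _ <| iInf_le_of_le _ <| iInf_le_of_le (BD.shift J) le_rfl

theorem Cfg.dil_fin (h : Cfg n p s p' s') (α' : ℝ≥0∞) {r : ℝ} (hr : 0 < r)
    {g : (Fin n → ℝ) → ℝ} (hg : discNorm n p' s' g ≤ 1) :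
    discNormR n p' s' r (dil n α' r g) < ∞ := by
  have h1 := h.dil_normR α' hr g
  rw [lt_top_iff_ne_top]
  intro h2
  rw [h2, ENNReal.mul_top (by simpa using Real.rpow_pos_of_pos hr _)] at h1
  rw [← h1] at hg
  simp at hg

theorem BLF.main (t : BLF n p' s' α' T M) (h : Cfg n p s p' s') {α : ℝ≥0∞}
    (hα : 1 / α + 1 / α' = 1) :
    ∃ g : (Fin n → ℝ) → ℝ, memDA n p s α g ∧
        ∀ f, memH n p' s' α' f → T f = ∫ x, f x * g x := by
  obtain ⟨w, hw1, hw2, hw3, hw4, hw5⟩ := h.weight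
  have hw : Wt n p' s' w := ⟨hw1, hw2, hw3, hw4, hw5⟩
  obtain ⟨g0, hg0m, hg0, hE⟩ := t.density h hw
  set G : (Fin n → ℝ) → ℝ := fun x => g0 x / w x with hGdef
  have hGm : Measurable G := hg0m.div hw1
  have hwG : ∀ x, w x * G x = g0 x := fun x => mul_div_cancel₀ _ (hw2 x).ne'
  have hTW : ∀ b : (Fin n → ℝ) → ℝ, Measurable b → (∃ m : ℕ, ∀ x, |b x| ≤ m * w x) →
      T b = ∫ x, b x * G x := by
    rintro b hb ⟨m, hm⟩
    have h1 := t.density_bdd h hw hg0 hE (φ := fun x => b x / w x) (hb.div hw1) (C := m) fun x => by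
      rw [abs_div, abs_of_pos (hw2 x), div_le_iff₀ (hw2 x)]; exact hm x
    have h2 : (fun x => b x / w x * w x) = b := by
      funext x; exact div_mul_cancel₀ _ (hw2 x).ne'
    rw [h2] at h1
    rw [h1]
    congr 1; funext x; simp only [hGdef]; ring
  have hGl : LocallyIntegrable G volume := by
    rw [locallyIntegrable_iff]
    intro K hK
    obtain ⟨c, hc, hcw⟩ := hw4 K hK
    refine Integrable.mono (hg0.integrableOn.const_mul c⁻¹) hGm.aestronglyMeasurable ?_
    refine (ae_restrict_iff' hK.measurableSet).2 (Eventually.of_forall fun x hx => ?_)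
    rw [norm_mul, Real.norm_eq_abs, Real.norm_eq_abs, Real.norm_eq_abs, abs_div, abs_of_pos (hw2 x),
      abs_of_pos (inv_pos.2 hc), div_eq_inv_mul]
    exact mul_le_mul_of_nonneg_right (inv_anti₀ hc (hcw x hx)) (abs_nonneg _)
  have hGA : memDA n p s α G := by
    refine ⟨hGl, lt_of_le_of_lt (b := ENNReal.ofReal M) ?_ ENNReal.ofReal_lt_top⟩
    refine h.charA hα hw1 hw2 hw3 hGm.aemeasurable (by simpa only [hwG] using hg0) ?_
    intro b hbm hbw hbH hb1
    rw [← hTW b hbm hbw]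
    refine ENNReal.ofReal_le_ofReal ((t.bd b hbH).trans ?_)
    have : (hNorm n p' s' α' b).toReal ≤ 1 := ENNReal.toReal_le_of_le_ofReal zero_le_one (by simpa using hb1)
    nlinarith [t.nonneg]
  refine ⟨G, hGA, ?_⟩
  have hblock : ∀ (r : ℝ) (g : (Fin n → ℝ) → ℝ), 0 < r → LocallyIntegrable g volume →
      discNorm n p' s' g ≤ 1 → memH n p' s' α' (dil n α' r g) ∧
        T (dil n α' r g) = ∫ x, dil n α' r g x * G x := by
    intro r g hr hgl hg1
    have hbl := locInt_dil hgl hr α'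
    have hbf := h.dil_fin α' hr hg1
    set b := dil n α' r g with hb
    have hbH := (h.L1 α' hr hbl hbf).1
    refine ⟨hbH, ?_⟩
    have hbae := hbl.aestronglyMeasurable.aemeasurable
    set b' := hbae.mk b with hb'
    have hbb : b =ᵐ[volume] b' := hbae.ae_eq_mk
    have hb'm : Measurable b' := hbae.measurable_mk
    have hb'l : LocallyIntegrable b' volume := hbl.congr hbb
    have hb'f : discNormR n p' s' r b' < ∞ := by rw [← h.norm_ae' r hbb]; exact hbf
    have hb'H := (h.L1 α' hr hb'l hb'f).1
    rw [t.congr h hb'H hbb]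
    have hI : ∫ x, b x * G x = ∫ x, b' x * G x :=
      integral_congr_ae (by filter_upwards [hbb] with x hx; rw [hx])
    rw [hI]
    set S : ℕ → Set (Fin n → ℝ) := fun m => {x | |b' x| ≤ m * w x} with hS
    have hSm : ∀ m, MeasurableSet (S m) := fun m =>
      measurableSet_le (measurable_abs.comp hb'm) (hw1.const_mul _)
    set bm : ℕ → (Fin n → ℝ) → ℝ := fun m => (S m).indicator b' with hbm
    have hbmm : ∀ m, Measurable (bm m) := fun m => hb'm.indicator (hSm m)
    have hbmle : ∀ m x, |bm m x| ≤ |b' x| := by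
      intro m x
      simp only [hbm]
      by_cases hx : x ∈ S m <;> simp [hx]
    have hbmle2 : ∀ m x, |b' x - bm m x| ≤ |b' x| := by
      intro m x
      simp only [hbm]
      by_cases hx : x ∈ S m <;> simp [hx]
    have hbmw : ∀ m x, |bm m x| ≤ m * w x := by
      intro m x
      simp only [hbm]
      by_cases hx : x ∈ S m
      · rw [Set.indicator_of_mem hx]; exact hx
      · rw [Set.indicator_of_notMem hx, abs_zero]; exact mul_nonneg (by positivity) (hw2 x).le
    have hev : ∀ x, ∀ᶠ m in atTop, bm m x = b' x := by
      intro x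
      obtain ⟨m0, hm0⟩ := exists_nat_ge (|b' x| / w x)
      filter_upwards [eventually_ge_atTop m0] with m hm
      refine Set.indicator_of_mem (s := S m) ?_ b'
      have : |b' x| ≤ m0 * w x := (div_le_iff₀ (hw2 x)).1 hm0
      refine this.trans (mul_le_mul_of_nonneg_right ?_ (hw2 x).le)
      exact_mod_cast hm
    have l1 : Tendsto (fun m => T (bm m)) atTop (𝓝 (T b')) := by
      have h1 := t.dct h hr (fun m x => b' x - bm m x) b' (fun m => hb'm.sub (hbmm m)) hb'm hb'l
        hbmle2 hb'f (fun x => tendsto_const_nhds.congr' (by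
          filter_upwards [hev x] with m hm
          rw [hm, sub_self]))
      have h2 : ∀ m, T (bm m) = T b' - T (fun x => b' x - bm m x) := by
        intro m
        have hl1 : LocallyIntegrable (bm m) volume :=
          hb'l.mono (hbmm m).aestronglyMeasurable (Eventually.of_forall (hbmle m))
        have hl2 : LocallyIntegrable (fun x => b' x - bm m x) volume := hb'l.sub hl1
        rw [eq_sub_iff_add_eq, ← t.add _ _
          (h.L1 α' hr hl1 ((h.norm_mono' r (hbmle m)).trans_lt hb'f)).1
          (h.L1 α' hr hl2 ((h.norm_mono' r (hbmle2 m)).trans_lt hb'f)).1]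
        congr 1; funext x; simp only [Pi.add_apply]; ring
      simp only [h2]
      simpa using h1.const_sub (T b')
    have l2 : Tendsto (fun m => ∫ x, bm m x * G x) atTop (𝓝 (∫ x, b' x * G x)) := by
      refine tendsto_integral_of_dominated_convergence (fun x => |b' x * G x|)
        (fun m => ((hbmm m).mul hGm).aestronglyMeasurable) (h.part1 hα hGA hb'H).abs
        (fun m => Eventually.of_forall fun x => ?_) (Eventually.of_forall fun x => ?_)
      · rw [Real.norm_eq_abs, abs_mul, abs_mul]
        exact mul_le_mul_of_nonneg_right (hbmle m x) (abs_nonneg _)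
      · refine tendsto_const_nhds.congr' ?_
        filter_upwards [hev x] with m hm
        rw [hm]
    have l3 : ∀ m, T (bm m) = ∫ x, bm m x * G x := fun m => hTW _ (hbmm m) ⟨m, hbmw m⟩
    simp only [l3] at l1
    exact tendsto_nhds_unique l1 l2
  rintro f ⟨hfl, c, rr, g, BD⟩
  have hfH : memH n p' s' α' f := ⟨hfl, c, rr, g, BD⟩
  have hS : ∀ J, T (fun x => ∑ j ∈ Finset.range J, c j * dil n α' (rr j) (g j) x) =
      ∫ x, (∑ j ∈ Finset.range J, c j * dil n α' (rr j) (g j) x) * G x := by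
    intro J
    induction J with
    | zero =>
      simp only [Finset.range_zero, Finset.sum_empty, zero_mul, integral_zero]
      exact (t.ae_zero h (Eventually.of_forall fun x => rfl)).2
    | succ J ih =>
      obtain ⟨hJH, hJT⟩ := hblock (rr J) (g J) (BD.rpos J) (BD.gloc J) (BD.gnorm J)
      have hPJ := BD.partial_mem J
      have e1 : (fun x => ∑ j ∈ Finset.range (J + 1), c j * dil n α' (rr j) (g j) x) =
          (fun x => ∑ j ∈ Finset.range (J + 1), c j * dil n α' (rr j) (g j) x) := rfl
      have hcH : memH n p' s' α' (c J • dil n α' (rr J) (g J)) := by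
        refine (h.L1 α' (BD.rpos J) ((locInt_dil (BD.gloc J) (BD.rpos J) α').smul (c J)) ?_).1
        have := h.norm_smul' (rr J) (c J) (dil n α' (rr J) (g J))
        refine lt_of_eq_of_lt this ?_
        exact ENNReal.mul_lt_top ENNReal.ofReal_lt_top (h.dil_fin α' (BD.rpos J) (BD.gnorm J))
      have e2 : (fun x => ∑ j ∈ Finset.range (J + 1), c j * dil n α' (rr j) (g j) x) =
          (fun x => ∑ j ∈ Finset.range J, c j * dil n α' (rr j) (g j) x) +
            c J • dil n α' (rr J) (g J) := by
        funext x; simp [Finset.sum_range_succ]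
      rw [e2, t.add _ _ hPJ hcH, t.smul _ _ hJH, ih, hJT, ← integral_const_mul, ← integral_add
        (h.part1 hα hGA hPJ) ((h.part1 hα hGA hJH).const_mul _)]
      congr 1; funext x
      rw [Finset.sum_range_succ]; ring
  have htail : Tendsto (fun J => ∑' j, |c (j + J)|) atTop (𝓝 0) :=
    tendsto_sum_nat_add fun j => |c j|
  have l1 : Tendsto (fun J => T (fun x => ∑ j ∈ Finset.range J, c j * dil n α' (rr j) (g j) x))
      atTop (𝓝 (T f)) := by
    rw [tendsto_iff_norm_sub_tendsto_zero]
    refine squeeze_zero (fun _ => norm_nonneg _) (fun J => ?_) (by simpa using htail.const_mul M)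
    rw [norm_sub_rev]
    exact t.tail hfl BD J
  have l2 : Tendsto (fun J => ∫ x, (∑ j ∈ Finset.range J, c j * dil n α' (rr j) (g j) x) * G x)
      atTop (𝓝 (∫ x, f x * G x)) := by
    rw [tendsto_iff_norm_sub_tendsto_zero]
    refine squeeze_zero (g := fun J => (discNormA n p s α G).toReal * ∑' j, |c (j + J)|)
      (fun _ => norm_nonneg _) (fun J => ?_)
      (by simpa using htail.const_mul (discNormA n p s α G).toReal)
    have hd := tail_bound hfl BD hGm.aemeasurable
      (fun j => h.block_bound hα (BD.rpos j) hGm.aemeasurable (BD.gloc j) (BD.gnorm j)) J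
    rw [norm_sub_rev, ← integral_sub (h.part1 hα hGA hfH) (h.part1 hα hGA (BD.partial_mem J))]
    have h0 : 0 ≤ ∑' j, |c (j + J)| := tsum_nonneg fun j => abs_nonneg _
    rw [← toReal_enorm]
    refine ENNReal.toReal_le_of_le_ofReal (mul_nonneg ENNReal.toReal_nonneg h0) ?_
    rw [ENNReal.ofReal_mul ENNReal.toReal_nonneg, ENNReal.ofReal_toReal hGA.2.ne, mul_comm]
    refine (enorm_integral_le_lintegral_enorm _).trans (le_trans (le_of_eq ?_) hd)
    refine lintegral_congr fun x => ?_
    rw [← sub_mul, enorm_mul]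
  simp only [hS] at l1
  exact tendsto_nhds_unique l1 l2
end

/-- The map `g ↦ T_g`, `T_g(f) = ∫ fg`, is a linear isometric
isomorphism of `(L^{p⃗},ℓ^{s⃗})^α(ℝⁿ)` onto the dual of `H(p⃗',s⃗',α')`. -/
theorem statement12 (n : ℕ) (hn : 1 ≤ n) (p s p' s' : Fin n → ℝ≥0∞) (α α' : ℝ≥0∞)
    (hp : ∀ i, 1 < p i) (hs : ∀ i, 1 < s i) (hα : 1 ≤ α)
    (hα1 : invSum n s / (n : ℝ) ≤ (1 / α).toReal)
    (hα2 : (1 / α).toReal ≤ invSum n p / (n : ℝ))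
    (hp' : ∀ i, 1 / p i + 1 / p' i = 1) (hs' : ∀ i, 1 / s i + 1 / s' i = 1)
    (hαα' : 1 / α + 1 / α' = 1) :
    (∀ g : (Fin n → ℝ) → ℝ, memDA n p s α g →
      ∀ f : (Fin n → ℝ) → ℝ, memH n p' s' α' f →
        Integrable (fun x => f x * g x) volume) ∧
    (∀ g : (Fin n → ℝ) → ℝ, memDA n p s α g →
      (⨆ (f : (Fin n → ℝ) → ℝ)
          (_ : memH n p' s' α' f ∧ hNorm n p' s' α' f ≤ 1),
        ENNReal.ofReal |∫ x, f x * g x|) = discNormA n p s α g) ∧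
    (∀ g₁ g₂ : (Fin n → ℝ) → ℝ, memDA n p s α g₁ → memDA n p s α g₂ →
      (∀ f, memH n p' s' α' f → ∫ x, f x * g₁ x = ∫ x, f x * g₂ x) →
      g₁ =ᵐ[volume] g₂) ∧
    (∀ T : ((Fin n → ℝ) → ℝ) → ℝ,
      (∀ f g, memH n p' s' α' f → memH n p' s' α' g → T (f + g) = T f + T g) →
      (∀ (c : ℝ) f, memH n p' s' α' f → T (c • f) = c * T f) →
      (∃ M : ℝ, ∀ f, memH n p' s' α' f → |T f| ≤ M * (hNorm n p' s' α' f).toReal) →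
      ∃ g : (Fin n → ℝ) → ℝ, memDA n p s α g ∧
        ∀ f, memH n p' s' α' f → T f = ∫ x, f x * g x) := by
  have h : Cfg n p s p' s' := ⟨hp, hs, hp', hs'⟩
  refine ⟨fun g hg f hf => h.part1 hαα' hg hf, fun g hg => h.part2 hαα' hg,
    fun g₁ g₂ h1 h2 heq => h.part3 hαα' h1 h2 heq, fun T hadd hsmul hbd => ?_⟩
  obtain ⟨M, hM⟩ := hbd
  have t : BLF n p' s' α' T (max M 0) := by
    refine ⟨le_max_right _ _, hadd, hsmul, fun f hf => (hM f hf).trans ?_⟩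
    exact mul_le_mul_of_nonneg_right (le_max_left _ _) ENNReal.toReal_nonneg
  exact t.main h hαα'

end MixedAmalgam

end
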